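/- arXiv:0910.5945 — 2 statements merged into one kernel-verified Lean document; each statement's English description precedes it below -/
import Mathlib

section
/- The number of pairs (w, A), where w is a reduced word for the long word w0 in S_7 and A is a 4-element subset of {1,...,7} such that the induced word of w on A belongs to the reentrant set X, is exactly 9,631,498,240. Consequently, since there are 1,100,742,656 reduced words for w0 in S_7, the probability that a uniformly random such pair has reentrant induced word is 9,631,498,240/(C(7,4)·1,100,742,656) = 1/4. -/
/-- The adjacent transposition `s_a`, swapping `a` and `a+1`, as a permutation of `ℕ`. -/
def adjTransposition (a : ℕ) : Equiv.Perm ℕ := Equiv.swap a (a + 1)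

/-- The long word `w₀ = [n, n-1, …, 2, 1]` in `S_n`: the permutation of `ℕ` sending
`i` to `n + 1 - i` for `i ∈ {1, …, n}` and fixing all other natural numbers. -/
def longWord (n : ℕ) : Equiv.Perm ℕ :=
  Function.Involutive.toPerm (fun i => if 1 ≤ i ∧ i ≤ n then n + 1 - i else i)
    (by intro i; dsimp only; split_ifs <;> omega)

/-- `w` is a reduced word for the long word in `S_n`: a sequence of letters in
`{1, …, n-1}` of length `C(n,2)` whose associated product of adjacent
transpositions `s_{a_1} s_{a_2} ⋯ s_{a_m}` equals `w₀`. -/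
def IsReducedWord (n : ℕ) (w : List ℕ) : Prop :=
  w.length = n.choose 2 ∧ (∀ a ∈ w, 1 ≤ a ∧ a ≤ n - 1) ∧
    (w.map adjTransposition).prod = longWord n

/-- Auxiliary recursion computing the induced word on a subset `A` of wires:
`π` is the current permutation `π_{k-1}` (with `π j` the wire in position `j`);
at a step with letter `a`, the wires `π a` and `π (a+1)` cross, and if both lie
in `A` we record the position of `a` among the positions currently occupied by
the wires of `A`. -/
def inducedAux (A : Finset ℕ) : List ℕ → Equiv.Perm ℕ → List ℕ
  | [], _ => []
  | a :: rest, π =>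
      (if π a ∈ A ∧ π (a + 1) ∈ A
        then [((Finset.Icc 1 a).filter (fun p => π p ∈ A)).card]
        else []) ++ inducedAux A rest (π * adjTransposition a)

/-- The induced word of the word `w` on the subset `A` of wires. -/
def inducedWord (w : List ℕ) (A : Finset ℕ) : List ℕ := inducedAux A w 1

/-- The reentrant set `X` of four reduced words for the long word in `S_4`. -/
def reentrantSet : Finset (List ℕ) :=
  {[1,2,3,2,1,2], [3,2,1,2,3,2], [2,1,2,3,2,1], [2,3,2,1,2,3]}

/-! ### Ascending paths of one-line words -/

/-- Exchange the entries in positions `a` and `a + 1` (counted from `1`). -/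
def swapAt (a : ℕ) (l : List ℕ) : List ℕ :=
  l.take (a - 1) ++ match l.drop (a - 1) with
    | x :: y :: r => y :: x :: r
    | r => r

@[simp] lemma swapAt_append (p q : List ℕ) (x y : ℕ) :
    swapAt (p.length + 1) (p ++ x :: y :: q) = p ++ y :: x :: q := by
  simp [swapAt]

lemma exists_eq_append_of_lt_length {a : ℕ} {l : List ℕ} (h₁ : 1 ≤ a) (h₂ : a < l.length) :
    ∃ p x y q, l = p ++ x :: y :: q ∧ a = p.length + 1 := by
  refine ⟨l.take (a - 1), l[a - 1], l[a], l.drop (a + 1), ?_, ?_⟩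
  · rw [List.getElem_cons_drop h₂]
    have := List.getElem_cons_drop (as := l) (i := a - 1) (by omega)
    rw [Nat.sub_add_cancel h₁] at this
    rw [this, List.take_append_drop]
  · simp only [List.length_take]
    omega

/-- `AscPath t u l`: the letters of `u`, applied to the list `l` one after the other, each exchange
an ascending pair of adjacent entries, and the final list is `t`. -/
inductive AscPath (t : List ℕ) : List ℕ → List ℕ → Prop
  | nil : AscPath t [] t
  | cons {p q u : List ℕ} {x y : ℕ} (hxy : x < y) (h : AscPath t u (p ++ y :: x :: q)) :
      AscPath t ((p.length + 1) :: u) (p ++ x :: y :: q)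

/-- The ascending pairs of adjacent entries of `l`, together with the entries before them
(preceded by `p`) and after them. -/
def ascents : List ℕ → List ℕ → List (List ℕ × ℕ × ℕ × List ℕ)
  | p, x :: y :: r =>
    if x < y then (p, x, y, r) :: ascents (p ++ [x]) (y :: r) else ascents (p ++ [x]) (y :: r)
  | _, [] => []
  | _, [_] => []

lemma mem_ascents {p' q : List ℕ} {x y : ℕ} (p l : List ℕ) :
    (p', x, y, q) ∈ ascents p l ↔
      ∃ r, p' = p ++ r ∧ l = r ++ x :: y :: q ∧ x < y := by
  fun_induction ascents p l with
  | case1 p a b r hab ih =>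
    rw [List.mem_cons, ih]
    constructor
    · rintro (h | ⟨s, rfl, h, hxy⟩)
      · simp only [Prod.mk.injEq] at h
        obtain ⟨rfl, rfl, rfl, rfl⟩ := h
        exact ⟨[], by simp [hab]⟩
      · exact ⟨a :: s, by simp [h, hxy]⟩
    · rintro ⟨_ | ⟨c, s⟩, rfl, h, hxy⟩
      · simp_all
      · simp only [List.cons_append, List.cons.injEq] at h
        obtain ⟨rfl, h⟩ := h
        exact Or.inr ⟨s, by simp [h, hxy]⟩
  | case2 p a b r hab ih =>
    rw [ih]
    constructor
    · rintro ⟨s, rfl, h, hxy⟩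
      exact ⟨a :: s, by simp [h, hxy]⟩
    · rintro ⟨_ | ⟨c, s⟩, rfl, h, hxy⟩
      · simp only [List.nil_append, List.cons.injEq] at h
        omega
      · simp only [List.cons_append, List.cons.injEq] at h
        obtain ⟨rfl, h⟩ := h
        exact ⟨s, by simp [h, hxy]⟩
  | case3 p => simp
  | case4 p a =>
    simp only [List.not_mem_nil, false_iff]
    rintro ⟨s, -, h, -⟩
    have := congrArg List.length h
    simp at this
    omega

lemma mem_ascents_nil {p q l : List ℕ} {x y : ℕ} :
    (p, x, y, q) ∈ ascents [] l ↔ l = p ++ x :: y :: q ∧ x < y := by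
  simp [mem_ascents]

lemma pairwise_ascents (p l : List ℕ) :
    (ascents p l).Pairwise fun m m' => m.1.length ≠ m'.1.length := by
  fun_induction ascents p l with
  | case1 p a b r hab ih =>
    refine List.pairwise_cons.2 ⟨?_, ih⟩
    rintro ⟨p', x, y, q⟩ h
    obtain ⟨s, rfl, -⟩ := (mem_ascents _ _).1 h
    simp
  | case2 p a b r hab ih => exact ih
  | case3 => exact List.Pairwise.nil
  | case4 => exact List.Pairwise.nil

/-- The list of the words of length `k` that are ascending paths from `l` to `t`. -/
def words (t : List ℕ) : ℕ → List ℕ → List (List ℕ)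
  | 0, l => if l = t then [[]] else []
  | k + 1, l => (ascents [] l).flatMap fun m =>
      (words t k (m.1 ++ m.2.2.1 :: m.2.1 :: m.2.2.2)).map ((m.1.length + 1) :: ·)

lemma mem_words {t : List ℕ} {k : ℕ} {l u : List ℕ} :
    u ∈ words t k l ↔ AscPath t u l ∧ u.length = k := by
  induction k generalizing l u with
  | zero =>
    rw [words, List.length_eq_zero_iff]
    constructor
    · split_ifs with h
      · rintro hu
        rw [List.mem_singleton] at hu
        subst hu h
        exact ⟨.nil, rfl⟩
      · simp
    · rintro ⟨h, rfl⟩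
      cases h
      simp
  | succ k ih =>
    simp only [words, List.mem_flatMap, List.mem_map, Prod.exists, mem_ascents_nil, ih]
    constructor
    · rintro ⟨p, x, y, q, ⟨rfl, hxy⟩, u, ⟨hu, rfl⟩, rfl⟩
      exact ⟨.cons hxy hu, rfl⟩
    · rintro ⟨h, hk⟩
      cases h with
      | nil => simp at hk
      | cons hxy h => exact ⟨_, _, _, _, ⟨rfl, hxy⟩, _, ⟨h, by simpa using hk⟩, rfl⟩

lemma nodup_words (t : List ℕ) (k : ℕ) (l : List ℕ) : (words t k l).Nodup := by
  induction k generalizing l with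
  | zero => rw [words]; split_ifs <;> simp
  | succ k ih =>
    refine List.nodup_flatMap.2 ⟨fun m _ => (ih _).map (List.cons_injective), ?_⟩
    refine (pairwise_ascents [] l).imp fun {m m'} h => ?_
    simp only [Function.onFun, List.disjoint_left, List.mem_map]
    rintro _ ⟨u, -, rfl⟩ ⟨u', -, h'⟩
    exact h (by simpa using (List.cons.inj h').1.symm)

/-! ### Inversions -/

/-- The number of inversions of a list. -/
def inversions : List ℕ → ℕ
  | [] => 0
  | x :: l => l.countP (· < x) + inversions l

lemma inversions_swap (p q : List ℕ) (x y : ℕ) :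
    inversions (p ++ y :: x :: q) + (if y < x then 1 else 0) =
      inversions (p ++ x :: y :: q) + if x < y then 1 else 0 := by
  induction p with
  | nil =>
    simp only [List.nil_append, inversions, List.countP_cons, decide_eq_true_eq]
    omega
  | cons a p ih =>
    have h : (p ++ y :: x :: q).countP (· < a) = (p ++ x :: y :: q).countP (· < a) :=
      List.Perm.countP_eq _ (List.Perm.append_left p (List.Perm.swap x y q))
    simp only [List.cons_append, inversions, h]
    omega

lemma AscPath.inversions_add_length {t u l : List ℕ} (h : AscPath t u l) :
    inversions l + u.length = inversions t := by
  induction h with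
  | nil => simp
  | cons hxy _ ih =>
    rename_i p q u x y _
    have := inversions_swap p q x y
    simp only [hxy, hxy.not_gt, if_true, if_false] at this
    simp only [List.length_cons]
    omega

lemma inversions_foldl_le (w l : List ℕ) (hw : ∀ a ∈ w, 1 ≤ a ∧ a < l.length) :
    inversions (w.foldl (fun l a => swapAt a l) l) ≤ inversions l + w.length ∧
      (inversions (w.foldl (fun l a => swapAt a l) l) = inversions l + w.length →
        AscPath (w.foldl (fun l a => swapAt a l) l) w l) := by
  induction w generalizing l with
  | nil => exact ⟨le_rfl, fun _ => .nil⟩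
  | cons a w ih =>
    obtain ⟨h₁, h₂⟩ := hw a (by simp)
    obtain ⟨p, x, y, q, rfl, rfl⟩ := exists_eq_append_of_lt_length h₁ h₂
    have hs := inversions_swap p q x y
    obtain ⟨hle, heq⟩ := ih (p ++ y :: x :: q) fun b hb => by
      simpa using hw b (List.mem_cons_of_mem _ hb)
    simp only [List.foldl_cons, swapAt_append, List.length_cons]
    refine ⟨by split_ifs at hs <;> omega, fun h => ?_⟩
    have hxy : x < y := by
      by_contra hxy
      rw [if_neg hxy] at hs
      omega
    simp only [hxy, hxy.not_gt, if_true, if_false] at hs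
    exact .cons hxy (heq (by omega))

lemma AscPath.foldl_eq {t u l : List ℕ} (h : AscPath t u l) :
    u.foldl (fun l a => swapAt a l) l = t := by
  induction h with
  | nil => rfl
  | cons _ _ ih => simpa using ih

lemma AscPath.letters {t u l : List ℕ} (h : AscPath t u l) :
    ∀ a ∈ u, 1 ≤ a ∧ a < l.length := by
  induction h with
  | nil => simp
  | cons _ _ ih =>
    intro a ha
    rcases List.mem_cons.1 ha with rfl | ha
    · simp
    · simpa using ih a ha

/-! ### One-line words of permutations -/

/-- The one-line word of a permutation of `{1, …, 7}`. -/
def oneLine (π : Equiv.Perm ℕ) : List ℕ := (List.range' 1 7).map π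

@[simp] lemma length_oneLine (π : Equiv.Perm ℕ) : (oneLine π).length = 7 := by
  simp [oneLine]

lemma oneLine_mul_adjTransposition (π : Equiv.Perm ℕ) {a : ℕ} (h₁ : 1 ≤ a) (h₂ : a < 7) :
    oneLine (π * adjTransposition a) = swapAt a (oneLine π) := by
  interval_cases a <;>
    simp [oneLine, swapAt, adjTransposition, List.range', Equiv.swap_apply_def]

lemma oneLine_mul_prod (w : List ℕ) (hw : ∀ a ∈ w, 1 ≤ a ∧ a < 7) (π : Equiv.Perm ℕ) :
    oneLine (π * (w.map adjTransposition).prod) =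
      w.foldl (fun l a => swapAt a l) (oneLine π) := by
  induction w generalizing π with
  | nil => simp
  | cons a w ih =>
    obtain ⟨h₁, h₂⟩ := hw a (by simp)
    rw [List.map_cons, List.prod_cons, ← mul_assoc, ih fun b hb => hw b (by simp [hb]),
      oneLine_mul_adjTransposition π h₁ h₂, List.foldl_cons]

lemma prod_apply_of_notMem (w : List ℕ) (hw : ∀ a ∈ w, 1 ≤ a ∧ a < 7) {i : ℕ}
    (hi : i = 0 ∨ 7 < i) : (w.map adjTransposition).prod i = i := by
  induction w with
  | nil => rfl
  | cons a w ih =>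
    obtain ⟨h₁, h₂⟩ := hw a (by simp)
    rw [List.map_cons, List.prod_cons, Equiv.Perm.mul_apply, ih fun b hb => hw b (by simp [hb])]
    exact Equiv.swap_apply_of_ne_of_ne (by omega) (by omega)

lemma prod_eq_longWord_iff (w : List ℕ) (hw : ∀ a ∈ w, 1 ≤ a ∧ a < 7) :
    (w.map adjTransposition).prod = longWord 7 ↔
      w.foldl (fun l a => swapAt a l) [1, 2, 3, 4, 5, 6, 7] = [7, 6, 5, 4, 3, 2, 1] := by
  have h := oneLine_mul_prod w hw 1
  rw [one_mul] at h
  change _ = w.foldl _ [1, 2, 3, 4, 5, 6, 7] at h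
  rw [← h]
  constructor
  · intro h
    rw [h]
    rfl
  · intro h
    ext i
    by_cases hi : i = 0 ∨ 7 < i
    · rw [prod_apply_of_notMem w hw hi]
      refine (if_neg ?_).symm
      omega
    · simp only [oneLine, List.range', List.map_cons, List.cons.injEq] at h
      obtain ⟨h1, h2, h3, h4, h5, h6, h7, -⟩ := h
      have : 1 ≤ i := by omega
      have : i ≤ 7 := by omega
      interval_cases i <;> assumption

lemma isReducedWord_iff (w : List ℕ) :
    IsReducedWord 7 w ↔ w ∈ words [7, 6, 5, 4, 3, 2, 1] 21 [1, 2, 3, 4, 5, 6, 7] := by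
  rw [mem_words, and_comm, IsReducedWord]
  refine and_congr_right fun hlen => ?_
  have hlen : w.length = 21 := hlen
  constructor
  · rintro ⟨hw, hprod⟩
    have hw : ∀ a ∈ w, 1 ≤ a ∧ a < 7 := fun a ha => by have := hw a ha; omega
    have hfold := (prod_eq_longWord_iff w hw).1 hprod
    have := (inversions_foldl_le w [1, 2, 3, 4, 5, 6, 7] hw).2
    rw [hfold, hlen] at this
    exact this rfl
  · intro h
    have hw : ∀ a ∈ w, 1 ≤ a ∧ a < 7 := h.letters
    exact ⟨fun a ha => by have := hw a ha; omega, (prod_eq_longWord_iff w hw).2 h.foldl_eq⟩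

/-! ### Reentrance as a sum of local contributions -/

/-- The sum over the steps of the word `u`, applied to the list `l`, of the weights
`g p x y q`, where `x` and `y` are the entries exchanged, `p` are the entries before them and `q`
the entries after them. -/
def pathWeight (g : List ℕ → ℕ → ℕ → List ℕ → ℕ) : List ℕ → List ℕ → ℕ
  | [], _ => 0
  | a :: u, l =>
    (match l.drop (a - 1) with
      | x :: y :: r => g (l.take (a - 1)) x y r
      | _ => 0) + pathWeight g u (swapAt a l)

@[simp] lemma pathWeight_cons_append (g : List ℕ → ℕ → ℕ → List ℕ → ℕ) (u p q : List ℕ)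
    (x y : ℕ) :
    pathWeight g ((p.length + 1) :: u) (p ++ x :: y :: q) =
      g p x y q + pathWeight g u (p ++ y :: x :: q) := by
  simp [pathWeight]

/-- Among the entries before and after the crossing of `x < y` there are two on different sides
that both exceed `y` or are both below `x`. -/
def Separates (p : List ℕ) (x y : ℕ) (q : List ℕ) : Prop :=
  ∃ c ∈ p, ∃ d ∈ q, (y < c ∧ y < d) ∨ (c < x ∧ d < x)

instance (p : List ℕ) (x y : ℕ) (q : List ℕ) : Decidable (Separates p x y q) :=
  inferInstanceAs (Decidable (∃ c ∈ p, ∃ d ∈ q, _))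

/-- The indicator function of `Separates`. -/
def separation (p : List ℕ) (x y : ℕ) (q : List ℕ) : ℕ := if Separates p x y q then 1 else 0

/-- The indicator function of `Separates` for the wires in `A`. -/
def separationOn (A : Finset ℕ) (p : List ℕ) (x y : ℕ) (q : List ℕ) : ℕ :=
  if x ∈ A ∧ y ∈ A then separation (p.filter (· ∈ A)) x y (q.filter (· ∈ A)) else 0

/-- The number of pairs of entries on different sides of the crossing of `x < y` that both
exceed `y` or are both below `x`. -/
def separatedPairs (p : List ℕ) (x y : ℕ) (q : List ℕ) : ℕ :=
  p.countP (y < ·) * q.countP (y < ·) + p.countP (· < x) * q.countP (· < x)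

lemma countP_eq_card_filter {l : List ℕ} (hl : l.Nodup) (P : ℕ → Prop) [DecidablePred P] :
    l.countP (fun a => P a) = (l.toFinset.filter P).card := by
  rw [List.countP_eq_length_filter, ← List.toFinset_card_of_nodup (hl.filter _),
    List.toFinset_filter]
  simp

lemma sum_separationOn {p q : List ℕ} {x y : ℕ} (hxy : x < y) (s : Finset ℕ)
    (hl : (p ++ x :: y :: q).Nodup) (hs : (p ++ x :: y :: q).toFinset = s) :
    ∑ A ∈ s.powersetCard 4, separationOn A p x y q = separatedPairs p x y q := by
  have hp : p.Nodup := hl.of_append_left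
  have hq : q.Nodup := (hl.of_append_right.of_cons).of_cons
  have hpq : ∀ a ∈ p, a ∉ q ∧ a ≠ x ∧ a ≠ y := by
    intro a ha
    have := (List.nodup_append.1 hl).2.2 a ha
    refine ⟨fun h => this a (by simp [h]) rfl, this x (by simp), this y (by simp)⟩
  have hqx : ∀ a ∈ q, a ≠ x ∧ a ≠ y := by
    have := hl.of_append_right
    simp only [List.nodup_cons, List.mem_cons, not_or] at this
    exact fun a ha => ⟨fun h => this.1.2 (h ▸ ha), fun h => this.2.1 (h ▸ ha)⟩
  have hind : ∀ A, separationOn A p x y q = if x ∈ A ∧ y ∈ A ∧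
      Separates (p.filter (· ∈ A)) x y (q.filter (· ∈ A)) then 1 else 0 := by
    intro A
    rw [separationOn, separation]
    split_ifs <;> tauto
  simp_rw [hind]
  rw [← Finset.card_filter, separatedPairs, countP_eq_card_filter hp (y < ·),
    countP_eq_card_filter hp (· < x), countP_eq_card_filter hq (y < ·),
    countP_eq_card_filter hq (· < x), ← Finset.card_product, ← Finset.card_product,
    ← Finset.card_union_of_disjoint]
  · symm
    refine Finset.card_bij (fun cd _ => {cd.1, cd.2, x, y}) ?_ ?_ ?_
    · rintro ⟨c, d⟩ h
      simp only [Finset.mem_union, Finset.mem_product, Finset.mem_filter, List.mem_toFinset] at h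
      have hc : c ∈ p := by tauto
      have hd : d ∈ q := by tauto
      have hcd : c ≠ d := fun h => (hpq c hc).1 (h ▸ hd)
      simp only [Finset.mem_filter, Finset.mem_powersetCard, ← hs]
      refine ⟨⟨?_, ?_⟩, by simp, by simp, c, by simp [hc], d, by simp [hd], by tauto⟩
      · intro a
        simp only [Finset.mem_insert, Finset.mem_singleton, List.mem_toFinset, List.mem_append,
          List.mem_cons]
        rintro (rfl | rfl | rfl | rfl) <;> tauto
      · have := hpq c hc
        have := hqx d hd
        rw [Finset.card_insert_of_notMem, Finset.card_insert_of_notMem,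
          Finset.card_pair hxy.ne] <;> simp <;> tauto
    · rintro ⟨c, d⟩ h ⟨c', d'⟩ h' heq
      simp only [Finset.mem_union, Finset.mem_product, Finset.mem_filter, List.mem_toFinset]
        at h h'
      have hc : c ∈ p := by tauto
      have hd : d ∈ q := by tauto
      have hc' : c' ∈ p := by tauto
      have hd' : d' ∈ q := by tauto
      dsimp only at heq
      have h1 : c ∈ ({c', d', x, y} : Finset ℕ) := heq ▸ (by simp)
      have h2 : d ∈ ({c', d', x, y} : Finset ℕ) := heq ▸ (by simp)
      simp only [Finset.mem_insert, Finset.mem_singleton] at h1 h2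
      have hcd : c ≠ d' := fun h => (hpq c hc).1 (h ▸ hd')
      have hdc : d ≠ c' := fun h => (hpq c' hc').1 (h ▸ hd)
      have := hpq c hc
      have := hqx d hd
      simp only [Prod.mk.injEq]
      tauto
    · intro A hA
      simp only [Finset.mem_filter, Finset.mem_powersetCard] at hA
      obtain ⟨⟨hAs, hA4⟩, hx, hy, c, hc, d, hd, h⟩ := hA
      simp only [List.mem_filter, decide_eq_true_eq] at hc hd
      refine ⟨(c, d), ?_, ?_⟩
      · simp only [Finset.mem_union, Finset.mem_product, Finset.mem_filter, List.mem_toFinset]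
        tauto
      · refine Finset.eq_of_subset_of_card_le ?_ ?_
        · intro a
          simp only [Finset.mem_insert, Finset.mem_singleton]
          rintro (rfl | rfl | rfl | rfl) <;> tauto
        · have hcd : c ≠ d := fun h => (hpq c hc.1).1 (h ▸ hd.1)
          have := hpq c hc.1
          have := hqx d hd.1
          rw [hA4, Finset.card_insert_of_notMem, Finset.card_insert_of_notMem,
            Finset.card_pair hxy.ne] <;> simp <;> tauto
  · rw [Finset.disjoint_left]
    rintro ⟨c, d⟩ h h'
    simp only [Finset.mem_product, Finset.mem_filter] at h h'
    omega

lemma AscPath.sum_pathWeight_separationOn {t u l : List ℕ} (h : AscPath t u l) {s : Finset ℕ}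
    (hl : l.Nodup) (hs : l.toFinset = s) :
    ∑ A ∈ s.powersetCard 4, pathWeight (separationOn A) u l = pathWeight separatedPairs u l := by
  induction h with
  | nil => simp [pathWeight]
  | cons hxy _ ih =>
    rename_i p q u x y _
    have hperm : (p ++ y :: x :: q).Perm (p ++ x :: y :: q) :=
      List.Perm.append_left p (List.Perm.swap x y q)
    simp_rw [pathWeight_cons_append]
    rw [Finset.sum_add_distrib, sum_separationOn hxy s hl hs,
      ih (hperm.nodup_iff.2 hl) (by rw [← hs, List.toFinset_eq_of_perm _ _ hperm])]

lemma card_filter_Icc_eq (A : Finset ℕ) (π : Equiv.Perm ℕ) {a : ℕ} (ha : a ≤ 7) :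
    ((Finset.Icc 1 a).filter (fun i => π i ∈ A)).card =
      (((oneLine π).take a).filter (· ∈ A)).length := by
  have h : (oneLine π).take a = (List.range' 1 a).map π := by
    rw [oneLine, ← List.map_take]
    interval_cases a <;> rfl
  have h' : Finset.Icc 1 a = (List.range' 1 a).toFinset := by
    ext i
    simp only [Finset.mem_Icc, List.mem_toFinset, List.mem_range'_1]
    omega
  rw [h, h', ← countP_eq_card_filter (List.nodup_range' ..), ← List.countP_eq_length_filter,
    List.countP_map]
  rfl

lemma AscPath.filter {t u l : List ℕ} (h : AscPath t u l) (A : Finset ℕ)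
    (π : Equiv.Perm ℕ) (hπ : oneLine π = l) :
    AscPath (t.filter (· ∈ A)) (inducedAux A u π) (l.filter (· ∈ A)) ∧
      pathWeight separation (inducedAux A u π) (l.filter (· ∈ A)) =
        pathWeight (separationOn A) u l := by
  induction h generalizing π with
  | nil => exact ⟨.nil, rfl⟩
  | cons hxy _ ih =>
    rename_i p q u x y _
    have hlen : p.length + (q.length + 1 + 1) = 7 := by
      simpa using (congrArg List.length hπ).symm
    have hget : ∀ i (hi : i < 7), (oneLine π)[i]? = some (π (i + 1)) := by
      intro i hi
      simp [oneLine, hi, add_comm]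
    have hx : π (p.length + 1) = x := by
      simpa [hπ] using (hget p.length (by omega)).symm
    have hy : π (p.length + 1 + 1) = y := by
      simpa [hπ] using (hget (p.length + 1) (by omega)).symm
    have hcard := card_filter_Icc_eq A π (a := p.length + 1) (by omega)
    rw [hπ, show (p ++ x :: y :: q).take (p.length + 1) = p ++ [x] by
      simp [List.take_append]] at hcard
    obtain ⟨ih₁, ih₂⟩ := ih (π * adjTransposition (p.length + 1)) (by
      rw [oneLine_mul_adjTransposition π (by omega) (by omega), hπ, swapAt_append])
    rw [inducedAux, hx, hy, hcard, pathWeight_cons_append, ← ih₂, separationOn]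
    by_cases hxA : x ∈ A <;> by_cases hyA : y ∈ A <;>
      simp only [hxA, hyA, List.filter_append, List.filter_cons, List.filter_nil, and_self,
        and_true, and_false, if_true, if_false, decide_true, decide_false,
        Bool.false_eq_true, and_true, List.nil_append, List.length_append, List.length_cons,
        List.length_nil, zero_add, List.cons_append] at ih₁ ⊢
    · exact ⟨.cons hxy ih₁, by rw [pathWeight_cons_append]⟩
    all_goals exact ih₁

lemma pathWeight_separation_words_four :
    ∀ l ∈ List.sublistsLen 4 [1, 2, 3, 4, 5, 6, 7],
      inversions l.reverse = inversions l + 6 ∧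
      ∀ u ∈ words l.reverse 6 l,
        pathWeight separation u l = if u ∈ reentrantSet then 1 else 0 := by
  decide +kernel

lemma pathWeight_separationOn_eq {w : List ℕ}
    (h : AscPath [7, 6, 5, 4, 3, 2, 1] w [1, 2, 3, 4, 5, 6, 7]) {A : Finset ℕ}
    (hA : A ∈ (Finset.Icc 1 7).powersetCard 4) :
    pathWeight (separationOn A) w [1, 2, 3, 4, 5, 6, 7] =
      if inducedWord w A ∈ reentrantSet then 1 else 0 := by
  obtain ⟨hpath, hweight⟩ := h.filter A 1 rfl
  rw [← hweight]
  have ht : [7, 6, 5, 4, 3, 2, 1].filter (· ∈ A) =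
      ([1, 2, 3, 4, 5, 6, 7].filter (· ∈ A)).reverse := by
    rw [← List.filter_reverse]
    rfl
  rw [ht] at hpath
  obtain ⟨hA, hcard⟩ := Finset.mem_powersetCard.1 hA
  have hmem : [1, 2, 3, 4, 5, 6, 7].filter (· ∈ A) ∈ List.sublistsLen 4 [1, 2, 3, 4, 5, 6, 7] := by
    refine List.mem_sublistsLen.2 ⟨List.filter_sublist, ?_⟩
    rw [← List.toFinset_card_of_nodup (List.Nodup.filter _ (by decide)), ← hcard]
    congr 1
    ext i
    simp only [List.mem_toFinset, List.mem_filter, decide_eq_true_eq]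
    refine ⟨And.right, fun hi => ⟨?_, hi⟩⟩
    have := Finset.mem_Icc.1 (hA hi)
    simp only [List.mem_cons, List.not_mem_nil, or_false]
    omega
  obtain ⟨hinv, hwords⟩ := pathWeight_separation_words_four _ hmem
  refine hwords _ (mem_words.2 ⟨hpath, ?_⟩)
  have := hpath.inversions_add_length
  omega

/-! ### Counting by dynamic programming -/

/-- The sum of the weights of all ascending paths of length `k` from `l` to `t`. -/
def totalWeight (t : List ℕ) (k : ℕ) (l : List ℕ) : ℕ :=
  ((words t k l).map fun u => pathWeight separatedPairs u l).sum

lemma card_reducedWord :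
    Nat.card {w : List ℕ // IsReducedWord 7 w} =
      (words [7, 6, 5, 4, 3, 2, 1] 21 [1, 2, 3, 4, 5, 6, 7]).length := by
  rw [← List.toFinset_card_of_nodup (nodup_words ..), ← Nat.card_eq_finsetCard]
  exact Nat.card_congr (Equiv.subtypeEquivRight fun w => by simp [isReducedWord_iff])

lemma card_reentrant_pairs :
    Nat.card {p : List ℕ × Finset ℕ //
        IsReducedWord 7 p.1 ∧ p.2 ⊆ Finset.Icc 1 7 ∧ p.2.card = 4 ∧
          inducedWord p.1 p.2 ∈ reentrantSet} =
      totalWeight [7, 6, 5, 4, 3, 2, 1] 21 [1, 2, 3, 4, 5, 6, 7] := by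
  set W := words [7, 6, 5, 4, 3, 2, 1] 21 [1, 2, 3, 4, 5, 6, 7] with hW
  have hcongr : Nat.card {p : List ℕ × Finset ℕ //
        IsReducedWord 7 p.1 ∧ p.2 ⊆ Finset.Icc 1 7 ∧ p.2.card = 4 ∧
          inducedWord p.1 p.2 ∈ reentrantSet} =
      ((W.toFinset ×ˢ (Finset.Icc 1 7).powersetCard 4).filter
        fun p => inducedWord p.1 p.2 ∈ reentrantSet).card := by
    rw [← Nat.card_eq_finsetCard]
    refine Nat.card_congr (Equiv.subtypeEquivRight fun p => ?_)
    simp only [Finset.mem_filter, Finset.mem_product, List.mem_toFinset,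
      Finset.mem_powersetCard, isReducedWord_iff, ← hW, and_assoc]
  rw [hcongr, Finset.card_filter, Finset.sum_product, totalWeight, ← hW,
    ← List.sum_toFinset _ (nodup_words ..)]
  refine Finset.sum_congr rfl fun w hw => ?_
  have hpath := (mem_words.1 (List.mem_toFinset.1 hw)).1
  rw [← hpath.sum_pathWeight_separationOn (by decide) (s := Finset.Icc 1 7) rfl]
  exact Finset.sum_congr rfl fun A hA => (pathWeight_separationOn_eq hpath hA).symm

lemma length_words_succ (t : List ℕ) (k : ℕ) (l : List ℕ) :
    (words t (k + 1) l).length = ((ascents [] l).map fun m =>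
      (words t k (m.1 ++ m.2.2.1 :: m.2.1 :: m.2.2.2)).length).sum := by
  simp [words, List.length_flatMap]

lemma totalWeight_succ (t : List ℕ) (k : ℕ) (l : List ℕ) :
    totalWeight t (k + 1) l = ((ascents [] l).map fun m =>
      separatedPairs m.1 m.2.1 m.2.2.1 m.2.2.2 *
          (words t k (m.1 ++ m.2.2.1 :: m.2.1 :: m.2.2.2)).length +
        totalWeight t k (m.1 ++ m.2.2.1 :: m.2.1 :: m.2.2.2)).sum := by
  rw [totalWeight, words, List.map_flatMap, List.flatMap, List.sum_flatten, List.map_map]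
  congr 1
  refine List.map_congr_left fun m hm => ?_
  obtain ⟨p, x, y, q⟩ := m
  obtain ⟨rfl, -⟩ := mem_ascents_nil.1 hm
  simp [totalWeight, Function.comp_def, List.sum_map_add, mul_comm]

/-- A binary search tree of entries with a key and two multiplicities. -/
inductive Tally where
  | leaf
  | node (l : Tally) (key n s : ℕ) (r : Tally)

namespace Tally

variable {M : Type*} [AddCommMonoid M] (F : ℕ → ℕ → ℕ → M)

/-- The sum of the values of `F` at the entries of a tree. -/
def sum : Tally → M
  | leaf => 0
  | node l key n s r => sum l + F key n s + sum r

/-- Add an entry to a tree, merging entries with equal keys. It is defined by `Tally.rec` to speed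
up its evaluation in the kernel. -/
noncomputable def insert (key n s : ℕ) (T : Tally) : Tally :=
  Tally.rec (node leaf key n s leaf) (fun l key' n' s' r hl hr =>
    Bool.rec (Bool.rec (node l key' n' s' hr) (node hl key' n' s' r) (Nat.ble key key'))
      (node l key' (n + n') (s + s') r) (Nat.beq key key')) T

variable {F} in
lemma sum_insert (hF : ∀ key n s n' s', F key (n + n') (s + s') = F key n s + F key n' s')
    (key n s : ℕ) (T : Tally) : (T.insert key n s).sum F = F key n s + T.sum F := by
  induction T with
  | leaf => simp [insert, sum]
  | node l key' n' s' r hl hr =>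
    change Tally.sum F (Bool.rec (Bool.rec (node l key' n' s' (r.insert key n s))
      (node (l.insert key n s) key' n' s' r) (Nat.ble key key'))
      (node l key' (n + n') (s + s') r) (Nat.beq key key')) = _
    cases h : Nat.beq key key'
    · cases Nat.ble key key' <;> simp only [sum, hl, hr] <;> abel
    · obtain rfl := Nat.eq_of_beq_eq_true h
      simp only [sum, hF]
      abel

end Tally

/-- The number of entries greater than `y`, defined by `List.rec` to speed up its evaluation in the
kernel. -/
noncomputable def gtCount (y : ℕ) (l : List ℕ) : ℕ :=
  List.rec 0 (fun c _ ih => Bool.rec (ih + 1) ih (Nat.ble c y)) l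

/-- The number of entries less than `x`, defined by `List.rec` to speed up its evaluation in the
kernel. -/
noncomputable def ltCount (x : ℕ) (l : List ℕ) : ℕ :=
  List.rec 0 (fun c _ ih => Bool.rec (ih + 1) ih (Nat.ble x c)) l

lemma gtCount_eq (y : ℕ) (l : List ℕ) : gtCount y l = l.countP (y < ·) := by
  induction l with
  | nil => rfl
  | cons c l ih =>
    change (Bool.rec (gtCount y l + 1) (gtCount y l) (Nat.ble c y) : ℕ) = _
    rw [List.countP_cons, ← ih]
    cases h : Nat.ble c y
    · simp [not_le.1 fun h' => Bool.false_ne_true (h.symm.trans (Nat.ble_eq_true_of_le h'))]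
    · simp [Nat.le_of_ble_eq_true h]

lemma ltCount_eq (x : ℕ) (l : List ℕ) : ltCount x l = l.countP (· < x) := by
  induction l with
  | nil => rfl
  | cons c l ih =>
    change (Bool.rec (ltCount x l + 1) (ltCount x l) (Nat.ble x c) : ℕ) = _
    rw [List.countP_cons, ← ih]
    cases h : Nat.ble x c
    · simp [not_le.1 fun h' => Bool.false_ne_true (h.symm.trans (Nat.ble_eq_true_of_le h'))]
    · simp [Nat.le_of_ble_eq_true h]

/-- The list of the last `k` octal digits, least significant first. -/
def octal : ℕ → ℕ → List ℕ
  | 0, _ => []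
  | k + 1, key => key % 8 :: octal k (key / 8)

lemma lt_of_mem_octal {k key a : ℕ} (h : a ∈ octal k key) : a < 8 := by
  induction k generalizing key with
  | zero => simp [octal] at h
  | succ k ih =>
    rcases List.mem_cons.1 h with rfl | h
    · omega
    · exact ih h

lemma length_octal (k key : ℕ) : (octal k key).length = k := by
  induction k generalizing key with
  | zero => rfl
  | succ k ih => simp [octal, ih]

lemma ofDigits_octal (k key : ℕ) : Nat.ofDigits 8 (octal k key) = key % 8 ^ k := by
  induction k generalizing key with
  | zero => simp [octal, Nat.mod_one]
  | succ k ih =>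
    rw [octal, Nat.ofDigits_cons, ih, pow_succ', Nat.mod_mul]

lemma octal_ofDigits_add (l : List ℕ) (hl : ∀ a ∈ l, a < 8) (c : ℕ) :
    octal l.length (Nat.ofDigits 8 l + 8 ^ l.length * c) = l := by
  induction l with
  | nil => rfl
  | cons a l ih =>
    have ha : a < 8 := hl a (by simp)
    rw [List.length_cons, octal, Nat.ofDigits_cons,
      show a + 8 * Nat.ofDigits 8 l + 8 ^ (l.length + 1) * c =
        a + 8 * (Nat.ofDigits 8 l + 8 ^ l.length * c) by ring,
      Nat.add_mul_mod_self_left, Nat.mod_eq_of_lt ha, Nat.add_mul_div_left _ _ (by norm_num),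
      Nat.div_eq_of_lt ha, zero_add, ih fun b hb => hl b (by simp [hb])]

/-- Add to `T` the lists obtained from one list by exchanging an ascending pair of adjacent
entries. The list is encoded in octal by `key`, it has multiplicity `n` and accumulated weight `s`.
It consists of the reverse of the first list argument followed by the second one, whose first
position has place value `b`. -/
noncomputable def spread (key n s : ℕ) : List ℕ → ℕ → List ℕ → Tally → Tally
  | pre, b, x :: y :: r, T => match Nat.ble y x with
    | true => spread key n s (x :: pre) (8 * b) (y :: r) T
    | false => spread key n s (x :: pre) (8 * b) (y :: r)
        (T.insert (key - 7 * (y - x) * b) n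
         (s + n * (gtCount y pre * gtCount y r + ltCount x pre * ltCount x r)))
  | _, _, _, T => T

/-- Apply `spread` to all entries of a tree. -/
noncomputable def advance : Tally → Tally → Tally
  | .leaf, acc => acc
  | .node l key n s r, acc => advance l (advance r (spread key n s [] 1 (octal 7 key) acc))

/-- Iterate `advance`. -/
noncomputable def advanceIter : ℕ → Tally → Tally
  | 0, T => T
  | k + 1, T => advanceIter k (advance T .leaf)

section

variable {M : Type*} [AddCommMonoid M] {F : ℕ → ℕ → ℕ → M}

lemma sum_spread (hF : ∀ key n s n' s', F key (n + n') (s + s') = F key n s + F key n' s')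
    (key c n s : ℕ) (l pre : List ℕ) (T : Tally)
    (hkey : key = Nat.ofDigits 8 (pre.reverse ++ l) + c) :
    (spread key n s pre (8 ^ pre.length) l T).sum F = T.sum F +
      ((ascents pre.reverse l).map fun m =>
        F (Nat.ofDigits 8 (m.1 ++ m.2.2.1 :: m.2.1 :: m.2.2.2) + c) n
          (s + n * separatedPairs m.1 m.2.1 m.2.2.1 m.2.2.2)).sum := by
  induction l generalizing pre T with
  | nil => simp [spread, ascents]
  | cons x l ih =>
    cases l with
    | nil => simp [spread, ascents]
    | cons y r =>
      have ih' := fun T => ih (x :: pre) T (by simpa using hkey)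
      simp only [List.length_cons, pow_succ', List.reverse_cons] at ih'
      rw [spread, ascents]
      cases h : Nat.ble y x
      · have hxy : x < y :=
          not_le.1 fun h' => Bool.false_ne_true (h.symm.trans (Nat.ble_eq_true_of_le h'))
        obtain ⟨d, rfl⟩ := Nat.exists_eq_add_of_lt hxy
        have hnew : key - 7 * (x + d + 1 - x) * 8 ^ pre.length =
            Nat.ofDigits 8 (pre.reverse ++ (x + d + 1) :: x :: r) + c := by
          rw [hkey]
          apply Nat.sub_eq_of_eq_add
          rw [show x + d + 1 - x = d + 1 by omega]
          simp only [Nat.ofDigits_append, Nat.ofDigits_cons, List.length_reverse]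
          ring
        simp only [ih', Tally.sum_insert hF, hnew, if_pos hxy, List.map_cons, List.sum_cons,
          separatedPairs, gtCount_eq, ltCount_eq, List.countP_reverse]
        abel
      · simp only [ih', if_neg (Nat.le_of_ble_eq_true h).not_gt]

end

/-- The contribution of a list `l` with multiplicity `n` and accumulated weight `s` to the number
and to the total weight of the paths to `t`, when `k` steps remain. -/
def contribution (t : List ℕ) (k key n s : ℕ) : ℕ × ℕ :=
  (n * (words t k (octal 7 key)).length,
    s * (words t k (octal 7 key)).length + n * totalWeight t k (octal 7 key))

lemma contribution_add (t : List ℕ) (k key n s n' s' : ℕ) :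
    contribution t k key (n + n') (s + s') =
      contribution t k key n s + contribution t k key n' s' := by
  simp only [contribution, Prod.mk_add_mk, Prod.mk.injEq]
  constructor <;> ring

lemma contribution_succ (t : List ℕ) (k key n s : ℕ) :
    contribution t (k + 1) key n s = ((ascents [] (octal 7 key)).map fun m =>
      contribution t k (Nat.ofDigits 8 (m.1 ++ m.2.2.1 :: m.2.1 :: m.2.2.2) +
          8 ^ 7 * (key / 8 ^ 7)) n
        (s + n * separatedPairs m.1 m.2.1 m.2.2.1 m.2.2.2)).sum := by
  have hmap : ∀ m ∈ ascents [] (octal 7 key),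
      contribution t k (Nat.ofDigits 8 (m.1 ++ m.2.2.1 :: m.2.1 :: m.2.2.2) +
          8 ^ 7 * (key / 8 ^ 7)) n (s + n * separatedPairs m.1 m.2.1 m.2.2.1 m.2.2.2) =
        (n * (words t k (m.1 ++ m.2.2.1 :: m.2.1 :: m.2.2.2)).length,
          s * (words t k (m.1 ++ m.2.2.1 :: m.2.1 :: m.2.2.2)).length +
          n * (separatedPairs m.1 m.2.1 m.2.2.1 m.2.2.2 *
            (words t k (m.1 ++ m.2.2.1 :: m.2.1 :: m.2.2.2)).length +
            totalWeight t k (m.1 ++ m.2.2.1 :: m.2.1 :: m.2.2.2))) := by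
    rintro ⟨p, x, y, q⟩ hm
    obtain ⟨hm, -⟩ := mem_ascents_nil.1 hm
    have hlen : (p ++ y :: x :: q).length = 7 := by
      simpa [length_octal] using (congrArg List.length hm).symm
    have hoct := octal_ofDigits_add (p ++ y :: x :: q) (fun a ha =>
      lt_of_mem_octal (k := 7) (key := key) (by
        rw [hm]
        exact (List.Perm.append_left p (List.Perm.swap x y q)).mem_iff.1 ha)) (key / 8 ^ 7)
    rw [hlen] at hoct
    simp only [contribution, hoct, Prod.mk.injEq, true_and]
    ring
  rw [List.map_congr_left hmap, contribution, length_words_succ, totalWeight_succ]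
  clear hmap
  generalize ascents [] (octal 7 key) = L
  induction L with
  | nil => simp
  | cons m L ih =>
    simp only [List.map_cons, List.sum_cons]
    rw [← ih, Prod.mk_add_mk, Prod.mk.injEq]
    constructor <;> ring

lemma sum_advance (t : List ℕ) (k : ℕ) (T acc : Tally) :
    (advance T acc).sum (contribution t k) =
      T.sum (contribution t (k + 1)) + acc.sum (contribution t k) := by
  induction T generalizing acc with
  | leaf => simp [advance, Tally.sum]
  | node l key n s r hl hr =>
    have h := sum_spread (contribution_add t k) key (8 ^ 7 * (key / 8 ^ 7)) n s (octal 7 key) []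
      acc (by rw [List.reverse_nil, List.nil_append, ofDigits_octal, Nat.mod_add_div])
    rw [List.length_nil, pow_zero, List.reverse_nil, ← contribution_succ] at h
    rw [advance, hl, hr, h, Tally.sum]
    abel

lemma sum_advanceIter (t : List ℕ) (k : ℕ) (T : Tally) :
    (advanceIter k T).sum (contribution t 0) = T.sum (contribution t k) := by
  induction k generalizing T with
  | zero => rfl
  | succ k ih => rw [advanceIter, ih, sum_advance, Tally.sum, add_zero]

/-- Whether a tree consists of a single given entry. -/
def Tally.isSingle (key n s : ℕ) : Tally → Bool
  | .node .leaf key' n' s' .leaf => Nat.beq key' key && (Nat.beq n' n && Nat.beq s' s)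
  | _ => false

lemma Tally.eq_of_isSingle {key n s : ℕ} {T : Tally} (h : T.isSingle key n s = true) :
    T = .node .leaf key n s .leaf := by
  unfold Tally.isSingle at h
  split at h
  · simp only [Bool.and_eq_true, Nat.beq_eq] at h
    obtain ⟨rfl, rfl, rfl⟩ := h
    rfl
  · simp at h

lemma length_words_and_totalWeight_of_isSingle {t l : List ℕ} (hl : ∀ a ∈ l, a < 8)
    (hl' : l.length = 7) (ht : ∀ a ∈ t, a < 8) (ht' : t.length = 7) {k n s : ℕ}
    (h : (advanceIter k (.node .leaf (Nat.ofDigits 8 l) 1 0 .leaf)).isSingle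
      (Nat.ofDigits 8 t) n s = true) :
    (words t k l).length = n ∧ totalWeight t k l = s := by
  have hsum := sum_advanceIter t k (.node .leaf (Nat.ofDigits 8 l) 1 0 .leaf)
  have hoct := octal_ofDigits_add l hl 0
  have hoct' := octal_ofDigits_add t ht 0
  rw [hl', mul_zero, add_zero] at hoct
  rw [ht', mul_zero, add_zero] at hoct'
  have hwords : words t 0 t = [[]] := if_pos rfl
  have htotal : totalWeight t 0 t = 0 := by simp [totalWeight, hwords, pathWeight]
  rw [Tally.eq_of_isSingle h] at hsum
  simp only [Tally.sum, contribution, hoct, hoct', hwords, htotal, List.length_singleton, zero_add,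
    add_zero, mul_one, mul_zero, one_mul, zero_mul, Prod.mk.injEq] at hsum
  exact ⟨hsum.1.symm, hsum.2.symm⟩

lemma isSingle_advanceIter :
    (advanceIter 21 (.node .leaf (Nat.ofDigits 8 [1, 2, 3, 4, 5, 6, 7]) 1 0 .leaf)).isSingle
      (Nat.ofDigits 8 [7, 6, 5, 4, 3, 2, 1]) 1100742656 9631498240 = true := by
  decide +kernel

/-- The number of pairs `(w, A)` with `w` a reduced word for the long word in `S₇`
and `A` a 4-element subset of `{1,…,7}` whose induced word is reentrant is
`9631498240`; consequently, with `1100742656` reduced words in total, the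
probability of a reentrant induced word is
`9631498240 / (C(7,4) * 1100742656) = 1/4`. -/
theorem reentrant_pairs_S7_count :
    Nat.card {p : List ℕ × Finset ℕ //
        IsReducedWord 7 p.1 ∧ p.2 ⊆ Finset.Icc 1 7 ∧ p.2.card = 4 ∧
          inducedWord p.1 p.2 ∈ reentrantSet} = 9631498240 ∧
    Nat.card {w : List ℕ // IsReducedWord 7 w} = 1100742656 ∧
    (9631498240 : ℚ) / (Nat.choose 7 4 * 1100742656) = 1 / 4 := by
  obtain ⟨hcount, htotal⟩ := length_words_and_totalWeight_of_isSingle (by decide) rfl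
    (by decide) rfl isSingle_advanceIter
  exact ⟨card_reentrant_pairs.trans htotal, card_reducedWord.trans hcount,
    by norm_num [show Nat.choose 7 4 = 35 from rfl]⟩
end

section
/- The number of pairs (w, A), where w is a reduced word for the long word w0 in S_8 and A is a 4-element subset of {1,...,8} such that the induced word of w on A belongs to the reentrant set X, is exactly 850,653,924,556,800. Consequently, since there are 48,608,795,688,960 reduced words for w0 in S_8, the probability that a uniformly random such pair has reentrant induced word is 850,653,924,556,800/(C(8,4)·48,608,795,688,960) = 1/4. -/
namespace SortingNetwork
open Finset
open scoped Nat

/-! ### Packing a table of small numbers into one natural number -/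

/-- The number whose `j`-th block of `b` binary digits is `h j`, for `j < n`. -/
def pack (b n : ℕ) (h : ℕ → ℕ) : ℕ := ∑ j ∈ range n, h j * 2 ^ (b * j)

theorem pack_succ (b n : ℕ) (h : ℕ → ℕ) :
    pack b (n + 1) h = pack b n h + h n * 2 ^ (b * n) :=
  sum_range_succ _ _

theorem pack_congr {b n : ℕ} {h h' : ℕ → ℕ} (H : ∀ j < n, h j = h' j) :
    pack b n h = pack b n h' :=
  sum_congr rfl fun j hj => by rw [H j (mem_range.1 hj)]

theorem pack_add (b n : ℕ) (h h' : ℕ → ℕ) :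
    pack b n (fun j => h j + h' j) = pack b n h + pack b n h' := by
  simp only [pack, add_mul, sum_add_distrib]

theorem pack_mul (b n c : ℕ) (h : ℕ → ℕ) :
    pack b n (fun j => c * h j) = c * pack b n h := by
  simp only [pack, mul_sum, mul_assoc]

theorem pack_sum {ι : Type*} (b n : ℕ) (s : Finset ι) (h : ι → ℕ → ℕ) :
    pack b n (fun j => ∑ i ∈ s, h i j) = ∑ i ∈ s, pack b n (h i) := by
  simp only [pack, sum_mul]
  exact sum_comm

theorem pack_lt {b n : ℕ} {h : ℕ → ℕ} (H : ∀ j < n, h j < 2 ^ b) :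
    pack b n h < 2 ^ (b * n) := by
  induction n with
  | zero => simp [pack]
  | succ n ih =>
    have h1 := ih fun j hj => H j (by omega)
    have h2 := Nat.mul_le_mul_right (2 ^ (b * n)) (H n (by omega))
    rw [pack_succ, mul_add, mul_one, pow_add, mul_comm (2 ^ (b * n))]
    rw [Nat.succ_mul] at h2
    omega

theorem land_add_mul_two_pow {k u v : ℕ} (x y : ℕ) (hu : u < 2 ^ k) (hv : v < 2 ^ k) :
    (u + x * 2 ^ k) &&& (v + y * 2 ^ k) = (u &&& v) + (x &&& y) * 2 ^ k := by
  have huv : u &&& v < 2 ^ k := lt_of_le_of_lt Nat.and_le_left hu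
  rw [add_comm u, add_comm v, add_comm (u &&& v), mul_comm x, mul_comm y, mul_comm (x &&& y)]
  refine Nat.eq_of_testBit_eq fun i => ?_
  rw [Nat.testBit_and, Nat.testBit_two_pow_mul_add _ hu, Nat.testBit_two_pow_mul_add _ hv,
    Nat.testBit_two_pow_mul_add _ huv]
  split_ifs <;> simp

/-- Selecting the blocks with index in `J` is a bitwise conjunction. -/
theorem pack_land {b n : ℕ} {h : ℕ → ℕ} (J : ℕ → Prop) [DecidablePred J]
    (H : ∀ j < n, h j < 2 ^ b) :
    pack b n h &&& pack b n (fun j => if J j then 2 ^ b - 1 else 0) =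
      pack b n (fun j => if J j then h j else 0) := by
  induction n with
  | zero => simp [pack]
  | succ n ih =>
    have hpos : 0 < 2 ^ b := by positivity
    rw [pack_succ, pack_succ, pack_succ, land_add_mul_two_pow, ih fun j hj => H j (by omega)]
    · split_ifs
      · rw [Nat.and_two_pow_sub_one_eq_mod, Nat.mod_eq_of_lt (H n (by omega))]
      · simp
    · exact pack_lt fun j hj => H j (by omega)
    · exact pack_lt fun j _ => by split_ifs <;> omega

/-- The top block of a packed table. -/
theorem top_of_pack_eq {b n v : ℕ} {h : ℕ → ℕ} (H : ∀ j < n, h j < 2 ^ b)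
    (e : pack b (n + 1) h = v * 2 ^ (b * n)) : h n = v := by
  have hlt := pack_lt H
  have hpos : 0 < 2 ^ (b * n) := by positivity
  have := congrArg (· / 2 ^ (b * n)) (pack_succ b n h ▸ e)
  simpa [Nat.add_mul_div_right _ _ hpos, Nat.div_eq_of_lt hlt, hpos] using this

/-- The mask selecting, among `8!` blocks, those with index `j` such that `j / a % b = t`
(when `a * b * c = 8!`). -/
def blockMask (a b c t : ℕ) : ℕ :=
  ((2 ^ (88 * a) - 1) * ((2 ^ (88 * (a * b * c)) - 1) / (2 ^ (88 * (a * b)) - 1))) <<< (88 * (a * t))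

theorem sum_range_ones_mul_two_pow (b a : ℕ) :
    ∑ x ∈ range a, (2 ^ b - 1) * 2 ^ (b * x) = 2 ^ (b * a) - 1 := by
  have h := geom_sum_mul_add (2 ^ b - 1) a
  rw [Nat.sub_add_cancel Nat.one_le_two_pow] at h
  simp only [pow_mul]
  rw [← mul_sum, mul_comm, ← h, Nat.add_sub_cancel]

theorem sum_range_div_eq {a b t : ℕ} (ht : t < b) (F : ℕ → ℕ) :
    ∑ x ∈ range (a * b), (if x / a = t then F x else 0) = ∑ x ∈ range a, F (a * t + x) := by
  rcases a.eq_zero_or_pos with rfl | ha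
  · simp
  have h1 : (range (a * b)).filter (fun x => x / a = t) = Ico (a * t) (a * t + a) := by
    ext x
    simp only [mem_filter, mem_range, mem_Ico]
    rw [Nat.div_eq_iff ha]
    have h2 : a * (t + 1) ≤ a * b := Nat.mul_le_mul_left _ ht
    rw [mul_add_one] at h2
    rw [mul_comm t a]
    omega
  rw [← sum_filter, h1, sum_Ico_eq_sum_range, Nat.add_sub_cancel_left]

theorem blockMask_eq_pack {a b c t n : ℕ} (ha : 0 < a) (ht : t < b) (hn : a * b * c = n) :
    blockMask a b c t = pack 88 n (fun j => if j / a % b = t then 2 ^ 88 - 1 else 0) := by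
  have key : ∀ c, pack 88 (a * b * c) (fun j => if j / a % b = t then 2 ^ 88 - 1 else 0) =
      (2 ^ (88 * a) - 1) * (∑ u ∈ range c, (2 ^ (88 * (a * b))) ^ u) * 2 ^ (88 * (a * t)) := by
    intro c
    induction c with
    | zero => simp [pack]
    | succ c ih =>
      have h1 : ∀ x ∈ range (a * b),
          (if (a * b * c + x) / a % b = t then 2 ^ 88 - 1 else 0) * 2 ^ (88 * (a * b * c + x)) =
          (2 ^ (88 * (a * b))) ^ c *
            (if x / a = t then (2 ^ 88 - 1) * 2 ^ (88 * x) else 0) := by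
        intro x hx
        have hx' : x / a < b := Nat.div_lt_of_lt_mul (mem_range.1 hx)
        rw [mul_assoc a b c, Nat.mul_add_div ha, Nat.mul_add_mod, Nat.mod_eq_of_lt hx']
        generalize 2 ^ 88 - 1 = B
        split_ifs
        · ring
        · simp
      have h2 : ∀ x, (2 ^ 88 - 1) * 2 ^ (88 * (a * t + x)) =
          2 ^ (88 * (a * t)) * ((2 ^ 88 - 1) * 2 ^ (88 * x)) := by
        intro x
        generalize 2 ^ 88 - 1 = B
        ring
      rw [mul_add_one, pack, sum_range_add, ← pack, ih, sum_congr rfl h1, ← mul_sum,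
        sum_range_div_eq ht, sum_congr rfl fun x _ => h2 x, ← mul_sum,
        sum_range_ones_mul_two_pow, sum_range_succ]
      ring
  have hab : 2 ≤ 2 ^ (88 * (a * b)) := by
    have : 0 < a * b := Nat.mul_pos ha (by omega)
    calc 2 = 2 ^ 1 := rfl
      _ ≤ _ := Nat.pow_le_pow_right (by norm_num) (by omega)
  rw [blockMask, ← hn, key, Nat.geomSum_eq hab, Nat.shiftLeft_eq, ← pow_mul, ← mul_assoc 88]

/-! ### The weak order on `S₈` in factorial base -/

/-- The digit of weight `m!` of `j` in factorial base. -/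
def digit (m j : ℕ) : ℕ := j / m ! % (m + 1)

/-- The increase of the factorial base code of a permutation when two adjacent entries are
exchanged that are followed by `m` further ones and whose digits differ by `d`. -/
def moveShift (m d : ℕ) : ℕ := (d + 1) * (m + 1)! - d * m !

/-- The code after exchanging the entries with digits of weights `(m + 1)!` and `m!`. -/
def next (m j : ℕ) : ℕ := j + moveShift m (digit m j - digit (m + 1) j)

/-- The (shifted) weight of a step that leads to an entry with digit `q + 1` of weight
`(m + 1)!`. -/
def weight (m q : ℕ) : ℕ := (m - q) * (6 - m) + 9 - (m - q) * q

/-- The weight of a step exchanging the entries with digits of weights `(m + 1)!` and `m!`,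
in terms of the resulting code `j`. -/
def codeWeight (m j : ℕ) : ℕ := ∑ q ∈ range (m + 1), if digit (m + 1) j = q + 1 then weight m q else 0

/-- The number of ascending paths of length `k` from the code `j` to the top. -/
def pathsToTop : ℕ → ℕ → ℕ
  | 0, j => if j + 1 = 8 ! then 1 else 0
  | k + 1, j => ∑ m ∈ range 7, if digit (m + 1) j ≤ digit m j then pathsToTop k (next m j) else 0

/-- The total weight of the ascending paths of length `k` from the code `j` to the top. -/
def weightToTop : ℕ → ℕ → ℕ
  | 0, _ => 0
  | k + 1, j => ∑ m ∈ range 7, if digit (m + 1) j ≤ digit m j then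
      weightToTop k (next m j) + codeWeight m (next m j) * pathsToTop k (next m j) else 0

/-- The table `h` moved along all ascending steps at the digits of weights `(m + 1)!`, `m!`. -/
def push (m : ℕ) (h : ℕ → ℕ) (j' : ℕ) : ℕ :=
  ∑ j ∈ range 8 !, if digit (m + 1) j ≤ digit m j ∧ next m j = j' then h j else 0

/-- The number of ascending paths of length `k` from the bottom to the code `j`. -/
def pathsFromBot : ℕ → ℕ → ℕ
  | 0, j => if j = 0 then 1 else 0
  | k + 1, j => ∑ m ∈ range 7, push m (pathsFromBot k) j

/-- The total weight of the ascending paths of length `k` from the bottom to the code `j`. -/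
def weightFromBot : ℕ → ℕ → ℕ
  | 0, _ => 0
  | k + 1, j => ∑ m ∈ range 7,
      (push m (weightFromBot k) j + codeWeight m j * push m (pathsFromBot k) j)

theorem digit_add_digit_succ_mul (m j : ℕ) :
    j / m ! % ((m + 1) * (m + 2)) = digit (m + 1) j * (m + 1) + digit m j := by
  rw [Nat.mod_mul, digit, digit, Nat.div_div_eq_div_mul, Nat.factorial_succ m,
    mul_comm (m !) (m + 1)]
  ring

theorem factorial_mul_eq {m : ℕ} (hm : m < 7) :
    m ! * ((m + 1) * (m + 2)) * (8 ! / (m + 2)!) = 8 ! := by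
  interval_cases m <;> rfl

theorem next_lt {m j : ℕ} (hm : m < 7) (h : digit (m + 1) j ≤ digit m j) (hj : j < 8 !) :
    next m j < 8 ! := by
  have hc := factorial_mul_eq hm
  have hr := digit_add_digit_succ_mul m j
  have hq : digit m j < m + 1 := Nat.mod_lt _ (by omega)
  obtain ⟨d, hd⟩ := Nat.exists_eq_add_of_le h
  have hpos : 0 < m ! := Nat.factorial_pos m
  set c := 8 ! / (m + 2)!
  set r := (m + 1) * (m + 2) with hrdef
  have hQ : j / m ! < r * c := by
    rw [Nat.div_lt_iff_lt_mul hpos, mul_comm, ← mul_assoc, hc]; exact hj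
  have hu : j / m ! / r < c := Nat.div_lt_of_lt_mul hQ
  have hdecomp := Nat.div_add_mod (j / m !) r
  have hdecomp' := Nat.div_add_mod j (m !)
  have hlo : j % m ! < m ! := Nat.mod_lt _ hpos
  have hsh : moveShift m d = m ! * ((d + 1) * (m + 1) - d) := by
    rw [moveShift, Nat.factorial_succ, Nat.mul_sub]
    congr 1 <;> ring
  have hle : d ≤ (d + 1) * (m + 1) := by nlinarith
  obtain ⟨e, he⟩ := Nat.exists_eq_add_of_le hle
  rw [next, hd, Nat.add_sub_cancel_left, hsh, he, Nat.add_sub_cancel_left]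
  have h1 : j / m ! + e + 1 ≤ r * c := by
    have h2 : r * (j / m ! / r + 1) ≤ r * c := Nat.mul_le_mul_left r hu
    rw [mul_add_one] at h2
    have h3 : digit (m + 1) j * (m + 1) + digit m j + e + 1 ≤ r := by
      have h4 : digit m j * (m + 1) + (m + 1) + digit (m + 1) j =
          digit (m + 1) j * (m + 1) + digit m j + e := by
        rw [hd]; nlinarith
      have h5 : (digit m j + 1) * (m + 1) ≤ (m + 1) * (m + 1) := Nat.mul_le_mul_right _ hq
      rw [hrdef]
      nlinarith
    omega
  calc j + m ! * e < m ! * (j / m !) + m ! + m ! * e := by omega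
    _ = m ! * (j / m ! + e + 1) := by ring
    _ ≤ m ! * (r * c) := Nat.mul_le_mul_left _ h1
    _ = 8 ! := by rw [← mul_assoc, hc]

theorem sum_push_mul {m : ℕ} (hm : m < 7) (h Φ : ℕ → ℕ) :
    ∑ j ∈ range 8 !, push m h j * Φ j =
      ∑ j ∈ range 8 !, h j * if digit (m + 1) j ≤ digit m j then Φ (next m j) else 0 := by
  simp only [push, sum_mul]
  rw [sum_comm]
  refine sum_congr rfl fun j hj => ?_
  by_cases hasc : digit (m + 1) j ≤ digit m j
  · have hlt := next_lt hm hasc (mem_range.1 hj)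
    simp [hasc, ite_mul, hlt]
  · simp [hasc]

theorem sum_pathsFromBot_mul (k n : ℕ) :
    ∑ j ∈ range 8 !, pathsFromBot k j * pathsToTop n j = pathsToTop (n + k) 0 := by
  induction k generalizing n with
  | zero => simp [pathsFromBot, Nat.factorial_pos]
  | succ k ih =>
    rw [add_comm k 1, ← add_assoc, ← ih (n + 1)]
    simp only [add_comm 1 k, pathsFromBot, sum_mul]
    rw [sum_comm, sum_congr rfl fun m hm => sum_push_mul (mem_range.1 hm) _ _, sum_comm]
    simp only [pathsToTop, mul_sum]

theorem sum_weightFromBot_mul (k n : ℕ) :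
    ∑ j ∈ range 8 !, (weightFromBot k j * pathsToTop n j + pathsFromBot k j * weightToTop n j) =
      weightToTop (n + k) 0 := by
  induction k generalizing n with
  | zero => simp [pathsFromBot, weightFromBot, Nat.factorial_pos]
  | succ k ih =>
    have h : ∀ j ∈ range 8 !, weightFromBot (k + 1) j * pathsToTop n j +
        pathsFromBot (k + 1) j * weightToTop n j =
        ∑ m ∈ range 7, (push m (weightFromBot k) j * pathsToTop n j +
          push m (pathsFromBot k) j *
            (weightToTop n j + codeWeight m j * pathsToTop n j)) := by
      intro j _
      rw [weightFromBot, pathsFromBot, sum_mul, sum_mul, ← sum_add_distrib]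
      exact sum_congr rfl fun m _ => by ring
    rw [add_comm k 1, ← add_assoc, ← ih (n + 1), add_comm 1 k, sum_congr rfl h, sum_comm]
    have h' : ∀ m ∈ range 7, ∑ j ∈ range 8 !, (push m (weightFromBot k) j * pathsToTop n j +
          push m (pathsFromBot k) j * (weightToTop n j + codeWeight m j * pathsToTop n j)) =
        ∑ j ∈ range 8 !, (weightFromBot k j *
            (if digit (m + 1) j ≤ digit m j then pathsToTop n (next m j) else 0) +
          pathsFromBot k j * (if digit (m + 1) j ≤ digit m j then weightToTop n (next m j) +
            codeWeight m (next m j) * pathsToTop n (next m j) else 0)) := by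
      intro m hm
      rw [sum_add_distrib, sum_push_mul (mem_range.1 hm),
        sum_push_mul (mem_range.1 hm) _ fun j => weightToTop n j + codeWeight m j * pathsToTop n j,
        ← sum_add_distrib]
    rw [sum_congr rfl h', sum_comm]
    simp only [pathsToTop, weightToTop, mul_sum, sum_add_distrib]

theorem sum_push_le {m : ℕ} (hm : m < 7) (h : ℕ → ℕ) :
    ∑ j ∈ range 8 !, push m h j ≤ ∑ j ∈ range 8 !, h j := by
  have := sum_push_mul hm h fun _ => 1
  simp only [mul_one] at this
  rw [this]
  exact sum_le_sum fun j _ => by split_ifs <;> simp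

theorem sum_pathsFromBot_le (k : ℕ) : ∑ j ∈ range 8 !, pathsFromBot k j ≤ 7 ^ k := by
  induction k with
  | zero => simp [pathsFromBot, Nat.factorial_pos]
  | succ k ih =>
    simp only [pathsFromBot]
    rw [sum_comm]
    calc _ ≤ ∑ m ∈ range 7, 7 ^ k :=
          sum_le_sum fun m hm => (sum_push_le (mem_range.1 hm) _).trans ih
      _ = 7 ^ (k + 1) := by simp [pow_succ, mul_comm]

theorem codeWeight_le {m : ℕ} (hm : m < 7) (j : ℕ) : codeWeight m j ≤ 18 := by
  have hw : ∀ q ∈ range (m + 1), weight m q ≤ 18 := by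
    intro q hq
    have := mem_range.1 hq
    interval_cases m <;> interval_cases q <;> decide
  rcases Nat.eq_zero_or_pos (digit (m + 1) j) with h0 | h0
  · simp [codeWeight, h0]
  · obtain ⟨e, he⟩ := Nat.exists_eq_add_of_lt h0
    rw [zero_add] at he
    simp only [codeWeight, he, Nat.add_right_cancel_iff, sum_ite_eq]
    split_ifs with hq
    · exact hw e hq
    · omega

theorem sum_weightFromBot_le (k : ℕ) :
    ∑ j ∈ range 8 !, weightFromBot k j ≤ 18 * k * 7 ^ k := by
  induction k with
  | zero => simp [weightFromBot]
  | succ k ih =>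
    simp only [weightFromBot]
    rw [sum_comm]
    have h : ∀ m ∈ range 7, ∑ j ∈ range 8 !,
        (push m (weightFromBot k) j + codeWeight m j * push m (pathsFromBot k) j) ≤
        18 * (k + 1) * 7 ^ k := by
      intro m hm
      rw [mem_range] at hm
      have h1 := (sum_push_le hm (weightFromBot k)).trans ih
      have h2 := (sum_push_le hm (pathsFromBot k)).trans (sum_pathsFromBot_le k)
      have h3 : ∑ j ∈ range 8 !, codeWeight m j * push m (pathsFromBot k) j ≤ 18 * 7 ^ k :=
        calc _ ≤ ∑ j ∈ range 8 !, 18 * push m (pathsFromBot k) j :=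
              sum_le_sum fun j _ => Nat.mul_le_mul_right _ (codeWeight_le hm j)
          _ ≤ _ := by rw [← mul_sum]; exact Nat.mul_le_mul_left _ h2
      rw [sum_add_distrib]
      calc _ ≤ 18 * k * 7 ^ k + 18 * 7 ^ k := add_le_add h1 h3
        _ = _ := by ring
    calc _ ≤ ∑ m ∈ range 7, 18 * (k + 1) * 7 ^ k := sum_le_sum h
      _ = 18 * (k + 1) * 7 ^ (k + 1) := by simp; ring

theorem lt_of_sum_le {h : ℕ → ℕ} {c : ℕ} (H : ∑ j ∈ range 8 !, h j ≤ c) (hc : c < 2 ^ 88) :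
    ∀ j < 8 !, h j < 2 ^ 88 := fun _ hj =>
  ((single_le_sum (fun _ _ => Nat.zero_le _) (mem_range.2 hj)).trans H).trans_lt hc

theorem weight_bound_lt {k : ℕ} (hk : k ≤ 28) : 18 * k * 7 ^ k < 2 ^ 88 :=
  calc 18 * k * 7 ^ k ≤ 18 * 28 * 7 ^ 28 :=
        Nat.mul_le_mul (Nat.mul_le_mul_left _ hk) (Nat.pow_le_pow_right (by norm_num) hk)
    _ < 2 ^ 88 := by norm_num

theorem paths_bound_lt {k : ℕ} (hk : k ≤ 28) : 7 ^ k < 2 ^ 88 :=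
  calc 7 ^ k ≤ 7 ^ 28 := Nat.pow_le_pow_right (by norm_num) hk
    _ < 2 ^ 88 := by norm_num

/-! ### The same recursions on packed tables -/

/-- The mask selecting the codes whose digits of weights `(m + 1)!` and `m!` are `p`, `p + d`
for some `p`. -/
def moveMask (m d : ℕ) : ℕ :=
  ∑ p ∈ range (m + 1 - d),
    blockMask m ! ((m + 1) * (m + 2)) (8 ! / (m + 2)!) (p * (m + 1) + (p + d))

/-- The operation `push m` on packed tables. -/
def packedPush (m N : ℕ) : ℕ :=
  ∑ d ∈ range (m + 1), (N &&& moveMask m d) <<< (88 * moveShift m d)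

/-- Multiplication by `codeWeight m` on packed tables. -/
def packedWeigh (m N : ℕ) : ℕ :=
  ∑ q ∈ range (m + 1), weight m q * (N &&& blockMask (m + 1)! (m + 2) (8 ! / (m + 2)!) (q + 1))

/-- The packed table `pathsFromBot k`. -/
def packedPaths : ℕ → ℕ
  | 0 => 1
  | k + 1 => ∑ m ∈ range 7, packedPush m (packedPaths k)

/-- The packed table `weightFromBot k`. -/
def packedWeights : ℕ → ℕ
  | 0 => 0
  | k + 1 => ∑ m ∈ range 7,
      (packedPush m (packedWeights k) + packedWeigh m (packedPush m (packedPaths k)))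

theorem moveMask_eq_pack {m : ℕ} (hm : m < 7) (d : ℕ) :
    moveMask m d =
      pack 88 8 ! (fun j => if digit m j = digit (m + 1) j + d then 2 ^ 88 - 1 else 0) := by
  have h1 : ∀ p ∈ range (m + 1 - d), p * (m + 1) + (p + d) < (m + 1) * (m + 2) := by
    intro p hp
    have hp' : p + d < m + 1 := by have := mem_range.1 hp; omega
    have hp'' : p ≤ m := by omega
    nlinarith
  rw [moveMask, sum_congr rfl fun p hp =>
    blockMask_eq_pack (Nat.factorial_pos m) (h1 p hp) (factorial_mul_eq hm), ← pack_sum]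
  refine pack_congr fun j _ => ?_
  have hq : digit m j < m + 1 := Nat.mod_lt _ (by omega)
  have h2 : ∀ p ∈ range (m + 1 - d),
      (if j / m ! % ((m + 1) * (m + 2)) = p * (m + 1) + (p + d) then 2 ^ 88 - 1 else 0) =
      if digit (m + 1) j = p then
        (if digit m j = digit (m + 1) j + d then 2 ^ 88 - 1 else 0) else 0 := by
    intro p hp
    have hp' : p + d < m + 1 := by have := mem_range.1 hp; omega
    rw [digit_add_digit_succ_mul, ← ite_and]
    refine if_congr ⟨fun h => ?_, ?_⟩ rfl rfl
    · have hdiv := congrArg (· / (m + 1)) h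
      have hmod := congrArg (· % (m + 1)) h
      simp only [mul_comm _ (m + 1), Nat.mul_add_div (Nat.succ_pos m), Nat.mul_add_mod,
        Nat.div_eq_of_lt hq, Nat.div_eq_of_lt hp', Nat.mod_eq_of_lt hq,
        Nat.mod_eq_of_lt hp', add_zero] at hdiv hmod
      exact ⟨hdiv, by rw [hdiv, hmod]⟩
    · rintro ⟨rfl, h⟩
      rw [h]
  rw [sum_congr rfl h2, sum_ite_eq]
  split_ifs with h3 h4 h4 <;> first | rfl | (rw [mem_range] at h3; omega)

theorem packedPush_pack {m : ℕ} (hm : m < 7) {h : ℕ → ℕ} (H : ∀ j < 8 !, h j < 2 ^ 88) :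
    packedPush m (pack 88 8 ! h) = pack 88 8 ! (push m h) := by
  rw [packedPush, pack.eq_1 88 (8 !) (push m h), sum_push_mul hm h fun j => 2 ^ (88 * j)]
  have h1 : ∀ d ∈ range (m + 1), (pack 88 8 ! h &&& moveMask m d) <<< (88 * moveShift m d) =
      ∑ j ∈ range 8 !, if digit m j = digit (m + 1) j + d then
        h j * 2 ^ (88 * (j + moveShift m d)) else 0 := by
    intro d _
    rw [moveMask_eq_pack hm, pack_land _ H, Nat.shiftLeft_eq, pack, sum_mul]
    refine sum_congr rfl fun j _ => ?_
    split_ifs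
    · ring
    · simp
  rw [sum_congr rfl h1, sum_comm]
  refine sum_congr rfl fun j _ => ?_
  have hq : digit m j < m + 1 := Nat.mod_lt _ (by omega)
  by_cases hasc : digit (m + 1) j ≤ digit m j
  · obtain ⟨e, he⟩ := Nat.exists_eq_add_of_le hasc
    have he' : e < m + 1 := by omega
    simp [he, next, he']
  · rw [if_neg hasc, mul_zero]
    exact sum_eq_zero fun d _ => if_neg (by omega)

theorem packedWeigh_pack {m : ℕ} (hm : m < 7) {h : ℕ → ℕ} (H : ∀ j < 8 !, h j < 2 ^ 88) :
    packedWeigh m (pack 88 8 ! h) = pack 88 8 ! (fun j => codeWeight m j * h j) := by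
  have hf : (m + 1)! * (m + 2) * (8 ! / (m + 2)!) = 8 ! := by
    conv_rhs => rw [← factorial_mul_eq hm]
    rw [Nat.factorial_succ m]; ring
  have h1 : ∀ q ∈ range (m + 1),
      weight m q * (pack 88 8 ! h &&& blockMask (m + 1)! (m + 2) (8 ! / (m + 2)!) (q + 1)) =
      pack 88 8 ! (fun j => (if digit (m + 1) j = q + 1 then weight m q else 0) * h j) := by
    intro q hq
    rw [mem_range] at hq
    rw [blockMask_eq_pack (Nat.factorial_pos _) (by omega) hf, pack_land _ H, ← pack_mul]
    refine pack_congr fun j _ => ?_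
    rw [ite_mul, zero_mul, mul_ite, mul_zero]
    rfl
  rw [packedWeigh, sum_congr rfl h1, ← pack_sum]
  exact pack_congr fun j _ => by rw [codeWeight, sum_mul]

theorem packedPaths_eq {k : ℕ} (hk : k ≤ 28) : packedPaths k = pack 88 8 ! (pathsFromBot k) := by
  induction k with
  | zero => simp [packedPaths, pack, pathsFromBot, Nat.factorial_pos]
  | succ k ih =>
    have H := lt_of_sum_le (sum_pathsFromBot_le k) (paths_bound_lt (by omega))
    simp only [packedPaths, pathsFromBot]
    rw [ih (by omega), pack_sum]
    exact sum_congr rfl fun m hm => packedPush_pack (mem_range.1 hm) H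

theorem packedWeights_eq {k : ℕ} (hk : k ≤ 28) :
    packedWeights k = pack 88 8 ! (weightFromBot k) := by
  induction k with
  | zero => simp [packedWeights, pack, weightFromBot]
  | succ k ih =>
    have H := lt_of_sum_le (sum_pathsFromBot_le k) (paths_bound_lt (by omega))
    have H' := lt_of_sum_le (sum_weightFromBot_le k) (weight_bound_lt (by omega))
    simp only [packedWeights, weightFromBot]
    rw [ih (by omega), packedPaths_eq (by omega), pack_sum]
    refine sum_congr rfl fun m hm => ?_
    rw [mem_range] at hm
    have H'' := lt_of_sum_le ((sum_push_le hm _).trans (sum_pathsFromBot_le k))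
      (paths_bound_lt (by omega))
    rw [packedPush_pack hm H, packedPush_pack hm H', packedWeigh_pack hm H'', pack_add]

theorem packed_values :
    packedPaths 28 = 48608795688960 * 2 ^ (88 * 40319) ∧
      packedWeights 28 = (850653924556800 + 252 * 48608795688960) * 2 ^ (88 * 40319) := by
  decide +kernel

theorem pathsToTop_bot : pathsToTop 28 0 = 48608795688960 := by
  have H := lt_of_sum_le (sum_pathsFromBot_le 28) (paths_bound_lt le_rfl)
  have h := top_of_pack_eq (n := 40319) (fun j hj => H j (hj.trans (by decide)))
    ((packedPaths_eq le_rfl).symm.trans packed_values.1)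
  rw [← h, ← zero_add 28, ← sum_pathsFromBot_mul]
  simp [pathsToTop, Nat.factorial]

theorem weightToTop_bot : weightToTop 28 0 = 850653924556800 + 252 * 48608795688960 := by
  have H := lt_of_sum_le (sum_weightFromBot_le 28) (weight_bound_lt le_rfl)
  have h := top_of_pack_eq (n := 40319) (fun j hj => H j (hj.trans (by decide)))
    ((packedWeights_eq le_rfl).symm.trans packed_values.2)
  rw [← h, ← zero_add 28, ← sum_weightFromBot_mul]
  simp [pathsToTop, weightToTop, Nat.factorial]

/-! ### Ascending paths in the weak order -/

/-- `AscPath L w M`: the letters of `w` successively exchange entries of the list `L` that are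
adjacent and in increasing order, and finally produce `M`. -/
inductive AscPath : List ℕ → List ℕ → List ℕ → Prop
  | nil (L : List ℕ) : AscPath L [] L
  | cons {pre post w M : List ℕ} {x y : ℕ} : x < y → AscPath (pre ++ y :: x :: post) w M →
      AscPath (pre ++ x :: y :: post) ((pre.length + 1) :: w) M

/-- Exchange the entries of `L` in the positions `t` and `t + 1`, counted from `0`. -/
def swapAt (t : ℕ) (L : List ℕ) : List ℕ :=
  L.take t ++ L.getD (t + 1) 0 :: L.getD t 0 :: L.drop (t + 2)

/-- The sum of `g pre x y post` over the steps `pre ++ x :: y :: post → pre ++ y :: x :: post`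
of the word `w` starting from `L`. -/
def stepSum (g : List ℕ → ℕ → ℕ → List ℕ → ℤ) : List ℕ → List ℕ → ℤ
  | _, [] => 0
  | L, a :: w =>
      g (L.take (a - 1)) (L.getD (a - 1) 0) (L.getD (a - 1 + 1) 0) (L.drop (a - 1 + 2)) +
        stepSum g (swapAt (a - 1) L) w

/-- A function of the steps of a path whose sum, for four wires, indicates reentrance. -/
def stepWeight (pre : List ℕ) (_ y : ℕ) (post : List ℕ) : ℤ :=
  post.countP (y < ·) * (pre.length - post.countP (· < y))

/-- The number of inversions of a list. -/
def inversions : List ℕ → ℕ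
  | [] => 0
  | x :: r => r.countP (· < x) + inversions r

/-- The words of the ascending paths of length `k` from `L` to `M`. -/
def ascWords (M : List ℕ) : ℕ → List ℕ → Finset (List ℕ)
  | 0, L => if L = M then {[]} else ∅
  | k + 1, L => (range (L.length - 1)).biUnion fun t =>
      if L.getD t 0 < L.getD (t + 1) 0 then (ascWords M k (swapAt t L)).image (List.cons (t + 1))
      else ∅

section Split

variable (pre post : List ℕ) (x y : ℕ)

@[simp] theorem take_split : (pre ++ x :: y :: post).take pre.length = pre := by simp

@[simp] theorem getD_split : (pre ++ x :: y :: post).getD pre.length 0 = x := by simp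

@[simp] theorem getD_succ_split : (pre ++ x :: y :: post).getD (pre.length + 1) 0 = y := by
  simp

@[simp] theorem drop_split : (pre ++ x :: y :: post).drop (pre.length + 2) = post := by
  simp [List.drop_append]

@[simp] theorem swapAt_split : swapAt pre.length (pre ++ x :: y :: post) = pre ++ y :: x :: post := by
  rw [swapAt, take_split, getD_split, getD_succ_split, drop_split]

theorem stepSum_split (g : List ℕ → ℕ → ℕ → List ℕ → ℤ) (w : List ℕ) :
    stepSum g (pre ++ x :: y :: post) ((pre.length + 1) :: w) =
      g pre x y post + stepSum g (pre ++ y :: x :: post) w := by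
  rw [stepSum, Nat.add_sub_cancel, take_split, getD_split, getD_succ_split, drop_split,
    swapAt_split]

theorem perm_swap_split : (pre ++ y :: x :: post).Perm (pre ++ x :: y :: post) :=
  (List.Perm.swap x y post).append_left pre

end Split

theorem exists_split {L : List ℕ} {t : ℕ} (h : t + 1 < L.length) :
    ∃ pre x y post, L = pre ++ x :: y :: post ∧ pre.length = t :=
  ⟨L.take t, L[t], L[t + 1], L.drop (t + 2), by
    rw [← List.drop_eq_getElem_cons, ← List.drop_eq_getElem_cons, List.take_append_drop],
    by simp; omega⟩

theorem inversions_append_of_perm (pre : List ℕ) {l l' : List ℕ} (h : l.Perm l') :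
    inversions (pre ++ l) + inversions l' = inversions (pre ++ l') + inversions l := by
  induction pre with
  | nil => simp [add_comm]
  | cons z pre ih =>
    have := (h.append_left pre).countP_eq (· < z)
    simp only [List.cons_append, inversions]
    omega

theorem inversions_swap {x y : ℕ} (pre post : List ℕ) (h : x < y) :
    inversions (pre ++ y :: x :: post) = inversions (pre ++ x :: y :: post) + 1 := by
  have := inversions_append_of_perm pre (List.Perm.swap x y post)
  have h' : ¬ y < x := by omega
  simp only [inversions, List.countP_cons, h, h', decide_true, decide_false, if_true] at this
  simp at this
  omega

theorem AscPath.inversions_eq {L w M : List ℕ} (h : AscPath L w M) :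
    inversions M = inversions L + w.length := by
  induction h with
  | nil => simp
  | cons hxy _ ih => rw [ih, inversions_swap _ _ hxy, List.length_cons]; omega

theorem mem_ascWords {M : List ℕ} {k : ℕ} {L w : List ℕ} :
    w ∈ ascWords M k L ↔ w.length = k ∧ AscPath L w M := by
  induction k generalizing L w with
  | zero =>
    simp only [ascWords, List.length_eq_zero_iff]
    constructor
    · intro h
      split_ifs at h with hL
      · exact ⟨by simpa using h, by rw [mem_singleton.1 h, hL]; exact .nil M⟩
      · simp at h
    · rintro ⟨rfl, h⟩
      cases h
      simp
  | succ k ih =>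
    simp only [ascWords, mem_biUnion, mem_range]
    constructor
    · rintro ⟨t, ht, h⟩
      obtain ⟨pre, x, y, post, rfl, rfl⟩ := exists_split (show t + 1 < L.length by omega)
      rw [getD_split, getD_succ_split, swapAt_split] at h
      split_ifs at h with hxy
      · obtain ⟨w, hw, rfl⟩ := mem_image.1 h
        rw [ih] at hw
        exact ⟨by simp [hw.1], .cons hxy hw.2⟩
      · simp at h
    · rintro ⟨hlen, h⟩
      cases h with
      | nil => simp at hlen
      | @cons pre post w _ x y hxy h =>
        refine ⟨pre.length, by simp, ?_⟩
        rw [getD_split, getD_succ_split, swapAt_split, if_pos hxy]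
        exact mem_image_of_mem _ (ih.2 ⟨by simpa using hlen, h⟩)

theorem sum_ascWords_succ {α : Type*} [AddCommMonoid α] (M : List ℕ) (k : ℕ) (L : List ℕ)
    (F : List ℕ → α) :
    ∑ w ∈ ascWords M (k + 1) L, F w = ∑ t ∈ range (L.length - 1),
      if L.getD t 0 < L.getD (t + 1) 0 then ∑ w ∈ ascWords M k (swapAt t L), F ((t + 1) :: w)
      else 0 := by
  rw [ascWords, sum_biUnion]
  · refine sum_congr rfl fun t _ => ?_
    split_ifs
    · exact sum_image fun _ _ _ _ h => (List.cons.inj h).2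
    · simp
  · intro t _ t' _ htt'
    refine disjoint_left.2 fun w h h' => htt' ?_
    beta_reduce at h h'
    split_ifs at h h'
    all_goals try simp at h
    all_goals try simp at h'
    obtain ⟨_, _, rfl⟩ := h
    obtain ⟨_, _, h'⟩ := h'
    simpa using (List.cons.inj h').1.symm

/-! ### Factorial base codes of lists -/

/-- The Lehmer code of a list, as a number in factorial base. -/
def code : List ℕ → ℕ
  | [] => 0
  | x :: r => r.countP (· < x) * r.length ! + code r

theorem code_lt (L : List ℕ) : code L < L.length ! := by
  induction L with
  | nil => simp [code]
  | cons x r ih =>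
    have h := Nat.mul_le_mul_right r.length ! (List.countP_le_length (p := (· < x)) (l := r))
    rw [code, List.length_cons, Nat.factorial_succ, add_mul, one_mul]
    omega

theorem code_append_of_perm (pre : List ℕ) {l l' : List ℕ} (h : l.Perm l') :
    ∃ K, code (pre ++ l) = K * l.length ! + code l ∧
      code (pre ++ l') = K * l.length ! + code l' := by
  induction pre with
  | nil => exact ⟨0, by simp⟩
  | cons z pre ih =>
    obtain ⟨K, h1, h2⟩ := ih
    obtain ⟨c, hc⟩ : l.length ! ∣ (pre ++ l).length ! :=
      Nat.factorial_dvd_factorial (by simp)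
    have hp := h.append_left pre
    refine ⟨(pre ++ l).countP (· < z) * c + K, ?_, ?_⟩
    · rw [List.cons_append, code, h1, hc]; ring
    · rw [List.cons_append, code, h2, ← hp.length_eq, ← hp.countP_eq, hc]; ring

theorem digit_of_code {m K c c' r : ℕ} (hr : r < m !) (hc : c < m + 1) (hc' : c' < m + 2) :
    digit m (K * (m + 2)! + (c' * (m + 1)! + (c * m ! + r))) = c ∧
      digit (m + 1) (K * (m + 2)! + (c' * (m + 1)! + (c * m ! + r))) = c' := by
  have h1 : (K * (m + 2)! + (c' * (m + 1)! + (c * m ! + r))) / m ! =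
      (K * (m + 2) + c') * (m + 1) + c := by
    have : K * (m + 2)! + (c' * (m + 1)! + (c * m ! + r)) =
        m ! * ((K * (m + 2) + c') * (m + 1) + c) + r := by
      rw [Nat.factorial_succ (m + 1), Nat.factorial_succ m]; ring
    rw [this, Nat.mul_add_div (Nat.factorial_pos m), Nat.div_eq_of_lt hr, add_zero]
  have h2 : m ! * (m + 1) = (m + 1)! := by rw [Nat.factorial_succ, mul_comm]
  constructor
  · rw [digit, h1, mul_comm, Nat.mul_add_mod, Nat.mod_eq_of_lt hc]
  · generalize K * (m + 2)! + (c' * (m + 1)! + (c * m ! + r)) = n at h1 ⊢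
    rw [digit, ← h2, ← Nat.div_div_eq_div_mul, h1, mul_comm _ (m + 1),
      Nat.mul_add_div (Nat.succ_pos m), Nat.div_eq_of_lt hc, add_zero, mul_comm, add_assoc,
      Nat.mul_add_mod, Nat.mod_eq_of_lt hc']

theorem digits_code_split (pre post : List ℕ) {x y : ℕ} (hxy : x ≠ y) :
    (digit (post.length + 1) (code (pre ++ x :: y :: post)) ≤
        digit post.length (code (pre ++ x :: y :: post)) ↔ x < y) ∧
      (x < y → next post.length (code (pre ++ x :: y :: post)) = code (pre ++ y :: x :: post) ∧
        digit (post.length + 1) (code (pre ++ y :: x :: post)) = post.countP (· < y) + 1) := by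
  obtain ⟨K, h1, h2⟩ := code_append_of_perm pre (List.Perm.swap y x post)
  simp only [code, List.length_cons, List.countP_cons] at h1 h2
  have hcx := List.countP_le_length (p := (· < x)) (l := post)
  have hcy := List.countP_le_length (p := (· < y)) (l := post)
  have hlt := code_lt post
  rcases hxy.lt_or_gt with h | h
  · have hle : post.countP (· < x) ≤ post.countP (· < y) :=
      List.countP_mono_left fun z _ hz => by simp at hz ⊢; omega
    simp [h, h.not_gt] at h1 h2
    obtain ⟨d1, d2⟩ := digit_of_code (K := K) hlt (Nat.lt_succ_of_le hcy)
      (show post.countP (· < x) < post.length + 2 by omega)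
    obtain ⟨e1, e2⟩ := digit_of_code (K := K) hlt (Nat.lt_succ_of_le hcx)
      (show post.countP (· < y) + 1 < post.length + 2 by omega)
    rw [← h1] at d1 d2
    rw [← h2] at e1 e2
    refine ⟨by simp [d1, d2, hle, h], fun _ => ⟨?_, e2⟩⟩
    obtain ⟨d, hd⟩ := Nat.exists_eq_add_of_le hle
    rw [next, d1, d2, hd, Nat.add_sub_cancel_left, h1, h2, hd, moveShift]
    have hfac : d * post.length ! ≤ (d + 1) * (post.length + 1)! :=
      Nat.mul_le_mul (by omega) (Nat.factorial_le (by omega))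
    obtain ⟨e, he⟩ := Nat.exists_eq_add_of_le hfac
    rw [he, Nat.add_sub_cancel_left]
    linarith
  · have hle : post.countP (· < y) ≤ post.countP (· < x) :=
      List.countP_mono_left fun z _ hz => by simp at hz ⊢; omega
    simp [h] at h1
    obtain ⟨d1, d2⟩ := digit_of_code (K := K) hlt (Nat.lt_succ_of_le hcy)
      (show post.countP (· < x) + 1 < post.length + 2 by omega)
    rw [← h1] at d1 d2
    refine ⟨?_, fun h' => by omega⟩
    rw [d1, d2]
    omega

theorem pairwise_gt_of_code {L : List ℕ} (h : code L + 1 = L.length !) :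
    L.Pairwise (· > ·) := by
  induction L with
  | nil => exact .nil
  | cons x r ih =>
    have hr := code_lt r
    have hc := List.countP_le_length (p := (· < x)) (l := r)
    rw [code, List.length_cons, Nat.factorial_succ] at h
    have hc' : r.countP (· < x) = r.length := by
      by_contra hne
      have := Nat.mul_le_mul_right r.length ! (show r.countP (· < x) + 1 ≤ r.length by omega)
      rw [add_mul, one_mul] at this
      rw [add_mul, one_mul] at h
      have := Nat.factorial_pos r.length
      omega
    rw [hc', add_mul, one_mul] at h
    refine List.Pairwise.cons (fun z hz => ?_) (ih (by omega))
    simpa using List.countP_eq_length.1 hc' z hz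

/-! ### Counting ascending paths in `S₈` -/

theorem sum_swaps_eq_sum_digits {α : Type*} [AddCommMonoid α] {L : List ℕ}
    (hL : L.Perm (List.range' 1 8)) {G : ℕ → α} {H : ℕ → ℕ → α}
    (hGH : ∀ pre x y post, L = pre ++ x :: y :: post → x < y →
      G pre.length = H post.length (code (pre ++ y :: x :: post))) :
    (∑ t ∈ range (L.length - 1), if L.getD t 0 < L.getD (t + 1) 0 then G t else 0) =
      ∑ m ∈ range 7, if digit (m + 1) (code L) ≤ digit m (code L) then
        H m (next m (code L)) else 0 := by
  have hlen : L.length = 8 := by rw [hL.length_eq]; rfl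
  rw [hlen, ← sum_range_reflect]
  refine sum_congr rfl fun m hm => ?_
  rw [mem_range] at hm
  obtain ⟨pre, x, y, post, rfl, hpre⟩ := exists_split (show 8 - 1 - 1 - m + 1 < L.length by omega)
  have hpost : post.length = m := by simp at hlen; omega
  have hxy : x ≠ y := by
    have := hL.nodup_iff.2 (by decide)
    rw [List.nodup_append] at this
    simp at this
    tauto
  obtain ⟨h1, h2⟩ := digits_code_split pre post hxy
  rw [← hpre, getD_split, getD_succ_split]
  subst hpost
  simp only [h1]
  split_ifs with h
  · rw [hGH _ _ _ _ rfl h, (h2 h).1]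
  · rfl

theorem code_add_one_eq_iff {L : List ℕ} (hL : L.Perm (List.range' 1 8)) :
    code L + 1 = 8 ! ↔ L = [8, 7, 6, 5, 4, 3, 2, 1] := by
  constructor
  · intro h
    have hlen : L.length = 8 := by rw [hL.length_eq]; rfl
    exact (hL.trans (by decide)).eq_of_pairwise (fun _ _ _ _ h h' => absurd h h'.asymm)
      (pairwise_gt_of_code (hlen ▸ h)) (by decide)
  · rintro rfl
    decide

theorem card_ascWords {k : ℕ} {L : List ℕ} (hL : L.Perm (List.range' 1 8)) :
    (ascWords [8, 7, 6, 5, 4, 3, 2, 1] k L).card = pathsToTop k (code L) := by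
  induction k generalizing L with
  | zero =>
    rw [ascWords, pathsToTop, if_congr (code_add_one_eq_iff hL) rfl rfl]
    split_ifs <;> rfl
  | succ k ih =>
    rw [card_eq_sum_ones, sum_ascWords_succ, pathsToTop]
    refine sum_swaps_eq_sum_digits hL fun pre x y post h _ => ?_
    subst h
    rw [swapAt_split, ← card_eq_sum_ones, ih ((perm_swap_split _ _ _ _).trans hL)]

theorem codeWeight_eq {m j c : ℕ} (hc : c < m + 1) (h : digit (m + 1) j = c + 1) :
    codeWeight m j = weight m c := by
  simp [codeWeight, h, hc]

theorem stepWeight_add_nine {pre post : List ℕ} {x y : ℕ}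
    (h : (pre ++ x :: y :: post).Perm (List.range' 1 8)) :
    stepWeight pre x y post + 9 = weight post.length (post.countP (· < y)) := by
  have hlen := h.length_eq
  simp at hlen
  have hpost : post.countP (y < ·) + post.countP (· < y) = post.length := by
    have hnd := h.nodup_iff.2 (by decide)
    rw [List.length_eq_countP_add_countP (p := (y < ·)) (l := post)]
    refine congrArg _ (List.countP_congr fun z hz => ?_)
    have : z ≠ y := by
      rintro rfl
      rw [List.nodup_append] at hnd
      simp [hz] at hnd
    simp
    omega
  rw [stepWeight]
  generalize post.countP (· < y) = c at *
  generalize post.countP (y < ·) = d at *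
  have hpre : pre.length = 6 - post.length := by omega
  have hm : post.length ≤ 6 := by omega
  rw [hpre]
  generalize post.length = m at *
  subst hpost
  have hd : d ≤ 6 := by omega
  have hc : c ≤ 6 := by omega
  clear hlen hpre h
  interval_cases d <;> interval_cases c <;> first | omega | decide

theorem sum_stepSum_ascWords {k : ℕ} {L : List ℕ} (hL : L.Perm (List.range' 1 8)) :
    ∑ w ∈ ascWords [8, 7, 6, 5, 4, 3, 2, 1] k L, (stepSum stepWeight L w + 9 * k) =
      weightToTop k (code L) := by
  induction k generalizing L with
  | zero =>
    rw [ascWords, weightToTop]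
    split_ifs <;> simp [stepSum]
  | succ k ih =>
    rw [sum_ascWords_succ, weightToTop]
    push_cast
    refine sum_swaps_eq_sum_digits hL (H := fun m j =>
      ((weightToTop k j : ℤ) + codeWeight m j * pathsToTop k j)) fun pre x y post h hxy => ?_
    subst h
    have hL' := (perm_swap_split pre post x y).trans hL
    rw [swapAt_split, ← ih hL', ← card_ascWords hL',
      codeWeight_eq (Nat.lt_succ_of_le List.countP_le_length)
        ((digits_code_split pre post hxy.ne).2 hxy).2, ← stepWeight_add_nine hL,
      mul_comm _ (card _ : ℤ), ← nsmul_eq_mul, ← sum_const, ← sum_add_distrib]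
    refine sum_congr rfl fun w _ => ?_
    rw [stepSum_split]
    ring

theorem card_ascWords_eight :
    (ascWords [8, 7, 6, 5, 4, 3, 2, 1] 28 (List.range' 1 8)).card = 48608795688960 :=
  (card_ascWords (.refl _)).trans pathsToTop_bot

theorem sum_stepSum_ascWords_eight :
    ∑ w ∈ ascWords [8, 7, 6, 5, 4, 3, 2, 1] 28 (List.range' 1 8),
      stepSum stepWeight (List.range' 1 8) w = 850653924556800 := by
  have h := sum_stepSum_ascWords (k := 28) (.refl (List.range' 1 8))
  rw [show code (List.range' 1 8) = 0 from rfl, weightToTop_bot, sum_add_distrib, sum_const,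
    card_ascWords_eight] at h
  norm_num at h
  linarith

/-! ### Permutations of `{1, …, 8}` in one-line notation -/

/-- The one-line notation `[π 1, …, π 8]`. -/
def oneLine (π : Equiv.Perm ℕ) : List ℕ := (List.range' 1 8).map π

theorem range'_split {a : ℕ} (h : 1 ≤ a ∧ a ≤ 7) :
    List.range' 1 8 = List.range' 1 (a - 1) ++ a :: (a + 1) :: List.range' (a + 2) (7 - a) := by
  obtain ⟨h1, h7⟩ := h
  interval_cases a <;> rfl

theorem oneLine_split (π : Equiv.Perm ℕ) {a : ℕ} (h : 1 ≤ a ∧ a ≤ 7) :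
    oneLine π = (List.range' 1 (a - 1)).map π ++
      π a :: π (a + 1) :: (List.range' (a + 2) (7 - a)).map π := by
  simp [oneLine, range'_split h]

theorem oneLine_mul_split (π : Equiv.Perm ℕ) {a : ℕ} (h : 1 ≤ a ∧ a ≤ 7) :
    oneLine (π * adjTransposition a) = (List.range' 1 (a - 1)).map π ++
      π (a + 1) :: π a :: (List.range' (a + 2) (7 - a)).map π := by
  have key : ∀ l : List ℕ, (∀ p ∈ l, p ≠ a ∧ p ≠ a + 1) →
      l.map ⇑(π * adjTransposition a) = l.map π := fun l hl =>
    List.map_congr_left fun p hp => by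
      rw [Equiv.Perm.mul_apply, adjTransposition, Equiv.swap_apply_of_ne_of_ne (hl p hp).1 (hl p hp).2]
  rw [oneLine_split _ h, key _ fun p hp => by simp at hp; omega,
    key _ fun p hp => by simp at hp; omega]
  simp [adjTransposition]

theorem inversions_oneLine_mul_le (π : Equiv.Perm ℕ) {w : List ℕ} (hw : ∀ a ∈ w, 1 ≤ a ∧ a ≤ 7) :
    inversions (oneLine (π * (w.map adjTransposition).prod)) ≤ inversions (oneLine π) + w.length ∧
      (inversions (oneLine (π * (w.map adjTransposition).prod)) =
          inversions (oneLine π) + w.length →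
        AscPath (oneLine π) w (oneLine (π * (w.map adjTransposition).prod))) := by
  induction w generalizing π with
  | nil => simpa using .nil _
  | cons a w ih =>
    have ha := hw a (by simp)
    obtain ⟨h1, h2⟩ := ih (π * adjTransposition a) fun b hb => hw b (by simp [hb])
    rw [List.map_cons, List.prod_cons, ← mul_assoc, List.length_cons]
    have hlt : π a ≠ π (a + 1) := by simp
    rcases hlt.lt_or_gt with h | h
    · have := inversions_swap ((List.range' 1 (a - 1)).map π)
        ((List.range' (a + 2) (7 - a)).map π) h
      rw [← oneLine_split π ha, ← oneLine_mul_split π ha] at this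
      refine ⟨by omega, fun he => ?_⟩
      have h3 := h2 (by omega)
      rw [oneLine_mul_split π ha] at h3
      have h4 := AscPath.cons h h3
      rw [← oneLine_split π ha] at h4
      simpa [Nat.sub_add_cancel ha.1] using h4
    · have := inversions_swap ((List.range' 1 (a - 1)).map π)
        ((List.range' (a + 2) (7 - a)).map π) h
      rw [← oneLine_split π ha, ← oneLine_mul_split π ha] at this
      exact ⟨by omega, fun he => by omega⟩

theorem AscPath.eq_oneLine {L w M : List ℕ} (h : AscPath L w M) (π : Equiv.Perm ℕ)
    (hL : L = oneLine π) :
    (∀ a ∈ w, 1 ≤ a ∧ a ≤ 7) ∧ M = oneLine (π * (w.map adjTransposition).prod) := by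
  induction h generalizing π with
  | nil => simpa using hL
  | @cons pre post w M x y hxy h ih =>
    have hlen := congrArg List.length hL
    simp [oneLine] at hlen
    have ha : 1 ≤ pre.length + 1 ∧ pre.length + 1 ≤ 7 := by omega
    rw [oneLine_split π ha] at hL
    obtain ⟨h1, h2⟩ := List.append_inj hL (by simp)
    simp only [List.cons.injEq] at h2
    obtain ⟨h3, h4⟩ := ih (π * adjTransposition (pre.length + 1)) (by
      rw [oneLine_mul_split π ha, ← h1, ← h2.1, ← h2.2.1, ← h2.2.2])
    refine ⟨by simpa using ⟨by omega, h3⟩, ?_⟩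
    rw [h4, List.map_cons, List.prod_cons, mul_assoc]

theorem oneLine_one : oneLine 1 = List.range' 1 8 := by simp [oneLine]

theorem oneLine_longWord : oneLine (longWord 8) = [8, 7, 6, 5, 4, 3, 2, 1] := rfl

theorem prod_adjTransposition_apply {w : List ℕ} (hw : ∀ a ∈ w, 1 ≤ a ∧ a ≤ 7) {i : ℕ}
    (hi : ¬ (1 ≤ i ∧ i ≤ 8)) : (w.map adjTransposition).prod i = i := by
  induction w with
  | nil => rfl
  | cons a w ih =>
    have := hw a (by simp)
    rw [List.map_cons, List.prod_cons, Equiv.Perm.mul_apply, ih fun b hb => hw b (by simp [hb]),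
      adjTransposition, Equiv.swap_apply_of_ne_of_ne] <;> omega

theorem eq_longWord_iff {π : Equiv.Perm ℕ} (hπ : ∀ i, ¬ (1 ≤ i ∧ i ≤ 8) → π i = i) :
    π = longWord 8 ↔ oneLine π = [8, 7, 6, 5, 4, 3, 2, 1] := by
  refine ⟨fun h => by rw [h, oneLine_longWord], fun h => Equiv.ext fun i => ?_⟩
  by_cases hi : 1 ≤ i ∧ i ≤ 8
  · rw [← oneLine_longWord] at h
    exact List.map_inj_left.1 h i (by simp; omega)
  · rw [hπ i hi]
    exact (if_neg hi).symm

theorem isReducedWord_iff {w : List ℕ} :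
    IsReducedWord 8 w ↔ w ∈ ascWords [8, 7, 6, 5, 4, 3, 2, 1] 28 (List.range' 1 8) := by
  rw [mem_ascWords, IsReducedWord, show Nat.choose 8 2 = 28 from rfl]
  refine and_congr_right fun hlen => ⟨fun ⟨hw, h⟩ => ?_, fun h => ?_⟩
  · have := (inversions_oneLine_mul_le 1 hw).2
    rw [one_mul, h, oneLine_one, oneLine_longWord, hlen] at this
    exact this (by decide)
  · obtain ⟨hw, hM⟩ := h.eq_oneLine 1 oneLine_one.symm
    refine ⟨hw, (eq_longWord_iff fun i => prod_adjTransposition_apply hw).2 ?_⟩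
    rw [hM, one_mul]

/-! ### Induced words -/

/-- The contribution to `stepWeight` of a subset `A` of the wires. -/
def subsetWeight (A : Finset ℕ) (pre : List ℕ) (x y : ℕ) (post : List ℕ) : ℤ :=
  if x ∈ A ∧ y ∈ A then stepWeight (pre.filter (· ∈ A)) x y (post.filter (· ∈ A)) else 0

theorem countP_eq_card_filter {l : List ℕ} (hl : l.Nodup) (p : ℕ → Prop) [DecidablePred p] :
    l.countP p = (l.toFinset.filter p).card := by
  have h := List.toFinset_card_of_nodup (hl.filter p)
  rw [List.countP_eq_length_filter, ← h, List.toFinset_filter]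
  simp only [decide_eq_true_eq]

theorem card_filter_Icc (π : Equiv.Perm ℕ) (A : Finset ℕ) (a : ℕ) :
    ((Icc 1 a).filter fun p => π p ∈ A).card =
      (((List.range' 1 a).map π).filter (· ∈ A)).length := by
  rw [← List.countP_eq_length_filter, List.countP_map]
  have : Icc 1 a = (List.range' 1 a).toFinset := by ext; simp; omega
  rw [this, ← countP_eq_card_filter List.nodup_range']
  rfl

theorem induced_path (A : Finset ℕ) {L w M : List ℕ} (h : AscPath L w M) (π : Equiv.Perm ℕ)
    (hL : L = oneLine π) :
    AscPath (L.filter (· ∈ A)) (inducedAux A w π) (M.filter (· ∈ A)) ∧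
      stepSum stepWeight (L.filter (· ∈ A)) (inducedAux A w π) =
        stepSum (subsetWeight A) L w := by
  induction h generalizing π with
  | nil => exact ⟨.nil _, rfl⟩
  | @cons pre post w M x y hxy h ih =>
    have hlen := congrArg List.length hL
    simp [oneLine] at hlen
    have ha : 1 ≤ pre.length + 1 ∧ pre.length + 1 ≤ 7 := by omega
    rw [oneLine_split π ha] at hL
    obtain ⟨h1, h2⟩ := List.append_inj hL (by simp)
    simp only [List.cons.injEq] at h2
    obtain ⟨h3, h4⟩ := ih (π * adjTransposition (pre.length + 1)) (by
      rw [oneLine_mul_split π ha, ← h1, ← h2.1, ← h2.2.1, ← h2.2.2])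
    rw [stepSum_split, inducedAux, ← h2.1, ← h2.2.1, ← h4, subsetWeight]
    by_cases hx : x ∈ A <;> by_cases hy : y ∈ A
    · have hcard : ((Icc 1 (pre.length + 1)).filter fun p => π p ∈ A).card =
          (pre.filter (· ∈ A)).length + 1 := by
        rw [card_filter_Icc, List.range'_concat, List.map_append, List.filter_append]
        rw [Nat.add_sub_cancel] at h1
        simp [← h1, add_comm 1, ← h2.1, hx]
      simp only [List.filter_append, List.filter_cons, hx, hy, decide_true, if_true, and_self] at h3 ⊢
      rw [hcard, List.singleton_append, stepSum_split]
      exact ⟨.cons hxy h3, rfl⟩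
    all_goals
      simp only [List.filter_append, List.filter_cons, hx, hy, decide_true, decide_false,
        if_true, and_self, and_true, and_false, if_false, List.nil_append, zero_add] at h3 ⊢
      simpa using h3

theorem stepWeight_map {f : ℕ → ℕ} (hf : StrictMono f) (pre : List ℕ) (x y : ℕ) (post : List ℕ) :
    stepWeight (pre.map f) (f x) (f y) (post.map f) = stepWeight pre x y post := by
  simp [stepWeight, List.countP_map, Function.comp_def, hf.lt_iff_lt]

theorem AscPath.of_map {f : ℕ → ℕ} (hf : StrictMono f) {L w M L' M' : List ℕ}
    (h : AscPath L w M) (hL : L'.map f = L) (hM : M'.map f = M) :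
    AscPath L' w M' ∧ stepSum stepWeight L w = stepSum stepWeight L' w := by
  induction h generalizing L' with
  | nil =>
    obtain rfl := List.map_injective_iff.2 hf.injective (hL.trans hM.symm)
    exact ⟨.nil _, rfl⟩
  | cons hxy _ ih =>
    simp only [List.map_eq_append_iff, List.map_eq_cons_iff] at hL
    obtain ⟨pre, _, rfl, rfl, x, _, rfl, rfl, y, post, rfl, rfl, rfl⟩ := hL
    obtain ⟨h1, h2⟩ := ih (L' := pre ++ y :: x :: post) (by simp) hM
    have h3 := AscPath.cons (hf.lt_iff_lt.1 hxy) h1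
    refine ⟨by simpa using h3, ?_⟩
    rw [stepSum_split, stepWeight_map hf, h2, List.length_map, stepSum_split]

theorem exists_strictMono_map_eq {A : Finset ℕ} (hA : A ∈ powersetCard 4 (Icc 1 8)) :
    ∃ f : ℕ → ℕ, StrictMono f ∧ [1, 2, 3, 4].map f = (List.range' 1 8).filter (· ∈ A) ∧
      [4, 3, 2, 1].map f = [8, 7, 6, 5, 4, 3, 2, 1].filter (· ∈ A) := by
  rw [mem_powersetCard] at hA
  have hlen : ((List.range' 1 8).filter (· ∈ A)).length = 4 := by
    have h := List.toFinset_card_of_nodup ((List.nodup_range' (s := 1) (n := 8)).filter (· ∈ A))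
    rw [← h, ← hA.2]
    congr 1
    ext z
    have := @hA.1 z
    simp at this ⊢
    grind
  have hsort := (List.pairwise_lt_range' (s := 1) (n := 8)).filter (· ∈ A)
  have hpos : ∀ z ∈ (List.range' 1 8).filter (· ∈ A), 0 < z := fun z hz => by simp at hz; omega
  rw [show [8, 7, 6, 5, 4, 3, 2, 1] = (List.range' 1 8).reverse from rfl, List.filter_reverse]
  generalize (List.range' 1 8).filter (· ∈ A) = l at *
  obtain ⟨a, b, c, d, rfl⟩ := List.length_eq_four.1 hlen
  simp at hsort hpos
  refine ⟨fun | 0 => 0 | 1 => a | 2 => b | 3 => c | i + 4 => d + i,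
    strictMono_nat_of_lt_succ fun i => ?_, rfl, rfl⟩
  rcases i with _ | _ | _ | _ | i <;> dsimp only <;> omega

theorem stepSum_four : ∀ u ∈ ascWords [4, 3, 2, 1] 6 [1, 2, 3, 4],
    stepSum stepWeight [1, 2, 3, 4] u = if u ∈ reentrantSet then 1 else 0 := by
  decide +kernel

theorem stepSum_subsetWeight {A : Finset ℕ} (hA : A ∈ powersetCard 4 (Icc 1 8)) {w : List ℕ}
    (hw : AscPath (List.range' 1 8) w [8, 7, 6, 5, 4, 3, 2, 1]) :
    stepSum (subsetWeight A) (List.range' 1 8) w =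
      if inducedWord w A ∈ reentrantSet then 1 else 0 := by
  obtain ⟨h1, h2⟩ := induced_path A hw 1 oneLine_one.symm
  obtain ⟨f, hf, h3, h4⟩ := exists_strictMono_map_eq hA
  obtain ⟨h5, h6⟩ := h1.of_map hf h3 h4
  have hlen := h5.inversions_eq
  rw [← h2, h6]
  refine stepSum_four _ (mem_ascWords.2 ⟨?_, h5⟩)
  rw [show inversions [4, 3, 2, 1] = 6 from rfl, show inversions [1, 2, 3, 4] = 0 from rfl] at hlen
  omega

/-! ### Averaging over the subsets -/

theorem card_filter_mem_powersetCard {S : Finset ℕ} {x y u v : ℕ} (h : [x, y, u, v].Nodup)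
    (hS : {x, y, u, v} ⊆ S) :
    ((powersetCard 4 S).filter fun A => (x ∈ A ∧ y ∈ A) ∧ u ∈ A ∧ v ∈ A).card = 1 := by
  have hc : ({x, y, u, v} : Finset ℕ).card = 4 := by
    have := List.toFinset_card_of_nodup h
    simpa using this
  rw [card_eq_one]
  refine ⟨{x, y, u, v}, ?_⟩
  ext A
  simp only [mem_filter, mem_powersetCard, mem_singleton]
  constructor
  · rintro ⟨⟨_, hA⟩, h⟩
    refine (eq_of_subset_of_card_le ?_ (by omega)).symm
    intro z hz
    simp only [mem_insert, mem_singleton] at hz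
    rcases hz with rfl | rfl | rfl | rfl <;> tauto
  · rintro rfl
    exact ⟨⟨hS, hc⟩, by simp⟩

theorem sum_card_mul_card {S U V : Finset ℕ} {x y : ℕ} (hUV : Disjoint U V)
    (hxy : [x, y].Nodup) (hU : ∀ u ∈ U, u ≠ x ∧ u ≠ y) (hV : ∀ v ∈ V, v ≠ x ∧ v ≠ y)
    (hS : {x, y} ∪ (U ∪ V) ⊆ S) :
    ∑ A ∈ powersetCard 4 S, (if x ∈ A ∧ y ∈ A then
      (U.filter (· ∈ A)).card * (V.filter (· ∈ A)).card else 0) = U.card * V.card := by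
  have h1 : ∀ A ∈ powersetCard 4 S, (if x ∈ A ∧ y ∈ A then
      (U.filter (· ∈ A)).card * (V.filter (· ∈ A)).card else 0) =
      ∑ u ∈ U, ∑ v ∈ V, if (x ∈ A ∧ y ∈ A) ∧ u ∈ A ∧ v ∈ A then 1 else 0 := by
    intro A _
    simp only [card_filter, sum_mul_sum, ite_and, mul_ite, mul_one, mul_zero]
    split_ifs <;> simp
  rw [sum_congr rfl h1, sum_comm, card_eq_sum_ones U, sum_mul]
  refine sum_congr rfl fun u hu => ?_
  rw [sum_comm, one_mul, card_eq_sum_ones]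
  refine sum_congr rfl fun v hv => ?_
  rw [← card_filter]
  refine card_filter_mem_powersetCard ?_ ?_
  · have := disjoint_left.1 hUV hu
    have huv : u ≠ v := fun h => this (h ▸ hv)
    have := hU u hu
    have := hV v hv
    simp at hxy ⊢
    tauto
  · refine Subset.trans ?_ hS
    intro z hz
    simp only [mem_insert, mem_singleton, mem_union] at hz ⊢
    rcases hz with rfl | rfl | rfl | rfl <;> tauto

theorem sum_subsetWeight {pre post : List ℕ} {x y : ℕ} {S : Finset ℕ}
    (hnd : (pre ++ x :: y :: post).Nodup) (hS : (pre ++ x :: y :: post).toFinset ⊆ S) :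
    ∑ A ∈ powersetCard 4 S, subsetWeight A pre x y post = stepWeight pre x y post := by
  have hnd' := hnd
  simp only [List.nodup_append, List.nodup_cons, List.mem_cons, not_or] at hnd'
  obtain ⟨hpre, ⟨⟨hxy, hx⟩, hy, hpost⟩, hdisj⟩ := hnd'
  have hcount : ∀ (l : List ℕ) (p : ℕ → Prop) [DecidablePred p] (A : Finset ℕ), l.Nodup →
      (l.filter (· ∈ A)).countP p = ((l.toFinset.filter p).filter (· ∈ A)).card := by
    intro l p _ A hl
    rw [countP_eq_card_filter (hl.filter _), List.toFinset_filter, filter_filter, filter_filter]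
    simp only [decide_eq_true_eq, and_comm]
  have hlength : ∀ A : Finset ℕ, (pre.filter (· ∈ A)).length =
      (pre.toFinset.filter (· ∈ A)).card := fun A => by
    rw [← List.countP_eq_length_filter, countP_eq_card_filter hpre]
  have h1 := sum_card_mul_card (S := S) (U := post.toFinset.filter (y < ·)) (V := pre.toFinset)
    (x := x) (y := y) (disjoint_left.2 fun z hz hz' => by
      simp at hz hz'; exact hdisj z hz' z (.inr (.inr hz.1)) rfl) (by simpa using hxy)
    (fun z hz => by simp at hz; exact ⟨ne_of_mem_of_not_mem hz.1 hx, ne_of_mem_of_not_mem hz.1 hy⟩)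
    (fun z hz => by simp at hz; exact ⟨hdisj z hz _ (.inl rfl), hdisj z hz _ (.inr (.inl rfl))⟩)
    (Subset.trans (fun z hz => by simp at hz ⊢; tauto) hS)
  have h2 := sum_card_mul_card (S := S) (U := post.toFinset.filter (y < ·))
    (V := post.toFinset.filter (· < y)) (x := x) (y := y)
    (disjoint_left.2 fun z hz hz' => by simp at hz hz'; omega) (by simpa using hxy)
    (fun z hz => by simp at hz; exact ⟨ne_of_mem_of_not_mem hz.1 hx, ne_of_mem_of_not_mem hz.1 hy⟩)
    (fun z hz => by simp at hz; exact ⟨ne_of_mem_of_not_mem hz.1 hx, ne_of_mem_of_not_mem hz.1 hy⟩)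
    (Subset.trans (fun z hz => by simp at hz ⊢; tauto) hS)
  rw [stepWeight, countP_eq_card_filter hpost, countP_eq_card_filter hpost,
    ← List.toFinset_card_of_nodup hpre, mul_sub]
  rw [← Nat.cast_mul, ← Nat.cast_mul, ← h1, ← h2, Nat.cast_sum, Nat.cast_sum, ← sum_sub_distrib]
  refine sum_congr rfl fun A _ => ?_
  rw [subsetWeight, stepWeight, hcount _ _ _ hpost, hcount _ _ _ hpost, hlength]
  split_ifs <;> simp [mul_sub]

theorem sum_stepSum_subsetWeight {L w M : List ℕ} (h : AscPath L w M) {S : Finset ℕ}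
    (hnd : L.Nodup) (hS : L.toFinset ⊆ S) :
    ∑ A ∈ powersetCard 4 S, stepSum (subsetWeight A) L w = stepSum stepWeight L w := by
  induction h with
  | nil => simp [stepSum]
  | @cons pre post _ _ x y _ _ ih =>
    have hp := perm_swap_split pre post x y
    simp only [stepSum_split, sum_add_distrib]
    rw [sum_subsetWeight hnd hS, ih (hp.nodup_iff.2 hnd)
      (by rwa [List.toFinset_eq_of_perm _ _ hp])]

/-- The pairs of a reduced word and a set of four wires with reentrant induced word. -/
def reentrantPairs : Finset (List ℕ × Finset ℕ) :=
  (ascWords [8, 7, 6, 5, 4, 3, 2, 1] 28 (List.range' 1 8) ×ˢ powersetCard 4 (Icc 1 8)).filter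
    fun p => inducedWord p.1 p.2 ∈ reentrantSet

theorem mem_reentrantPairs (p : List ℕ × Finset ℕ) :
    p ∈ reentrantPairs ↔ IsReducedWord 8 p.1 ∧ p.2 ⊆ Icc 1 8 ∧ p.2.card = 4 ∧
      inducedWord p.1 p.2 ∈ reentrantSet := by
  rw [reentrantPairs, mem_filter, mem_product, mem_powersetCard, isReducedWord_iff, and_assoc,
    and_assoc]

theorem sum_inducedWord_mem_reentrantSet (k : ℕ) :
    ∑ w ∈ ascWords [8, 7, 6, 5, 4, 3, 2, 1] k (List.range' 1 8),
      ∑ A ∈ powersetCard 4 (Icc 1 8), (if inducedWord w A ∈ reentrantSet then 1 else 0) =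
    ∑ w ∈ ascWords [8, 7, 6, 5, 4, 3, 2, 1] k (List.range' 1 8),
      stepSum stepWeight (List.range' 1 8) w := by
  refine sum_congr rfl fun w hw => ?_
  rw [mem_ascWords] at hw
  rw [← sum_stepSum_subsetWeight hw.2 (by decide) (S := Icc 1 8) (by decide)]
  exact sum_congr rfl fun A hA => (stepSum_subsetWeight hA hw.2).symm

theorem card_reentrantPairs : (reentrantPairs.card : ℤ) = 850653924556800 := by
  rw [← sum_stepSum_ascWords_eight, ← sum_inducedWord_mem_reentrantSet, reentrantPairs,
    card_filter, sum_product]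
  push_cast
  rfl

end SortingNetwork

/-- The number of pairs `(w, A)` with `w` a reduced word for the long word in `S₈`
and `A` a 4-element subset of `{1,…,8}` whose induced word is reentrant is
`850653924556800`; consequently, with `48608795688960` reduced words in total,
the probability of a reentrant induced word is
`850653924556800 / (C(8,4) * 48608795688960) = 1/4`. -/
theorem reentrant_pairs_S8_count :
    Nat.card {p : List ℕ × Finset ℕ //
        IsReducedWord 8 p.1 ∧ p.2 ⊆ Finset.Icc 1 8 ∧ p.2.card = 4 ∧
          inducedWord p.1 p.2 ∈ reentrantSet} = 850653924556800 ∧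
    Nat.card {w : List ℕ // IsReducedWord 8 w} = 48608795688960 ∧
    (850653924556800 : ℚ) / (Nat.choose 8 4 * 48608795688960) = 1 / 4 := by
  refine ⟨?_, ?_, by norm_num [Nat.choose]⟩
  · rw [Nat.subtype_card _ SortingNetwork.mem_reentrantPairs]
    exact_mod_cast SortingNetwork.card_reentrantPairs
  · exact (Nat.subtype_card _ fun _ => SortingNetwork.isReducedWord_iff.symm).trans
      SortingNetwork.card_ascWords_eight
end
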